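/- arXiv:2101.00684 — 4 statements merged into one kernel-verified Lean document; each statement's English description precedes it below -/
import Mathlib

section
/- Let μ > 0 and let N ≥ 2 be even, so T_N(μ) is invertible. Then for every n = 1, …, N/2 and c ∈ {1, 2}: Σ_{i=N−2n+1}^{N} |(T_N(μ)⁻¹)_{i, N−2n+c}| equals ‖Ĩ_{col(c)}‖₁ when n = 1, and equals ‖Ĩ_{col(c)}‖₁ + Σ_{i=1}^{n−1} μ^i (a_{n−i} + â_{n−i}) (∏_{p=1}^{i−1} â_{n−p}) |Ĩ_{2,c}| when 1 < n ≤ N/2, where the empty product (case i = 1) is interpreted as 1 and ‖Ĩ_{col(c)}‖₁ = |Ĩ_{1,c}| + |Ĩ_{2,c}|. -/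
/-- The `N × N` tridiagonal matrix `T_N(μ)` with diagonal `2, 4, …, 2N`, subdiagonal `μ`
and superdiagonal `-μ` (0-based indexing). -/
noncomputable def Tmat (N : ℕ) (μ : ℝ) : Matrix (Fin N) (Fin N) ℝ :=
  Matrix.of fun i j =>
    if (i : ℕ) = (j : ℕ) then 2 * (((i : ℕ) : ℝ) + 1)
    else if (i : ℕ) = (j : ℕ) + 1 then μ
    else if (j : ℕ) = (i : ℕ) + 1 then -μ
    else 0

/-- The recursive sequence `a_j` (with `d_i = 2i`):
`a_j = (d_{N−2j+2} + a_{j−1}μ²)/(d_{N−2j+1}d_{N−2j+2} + a_{j−1}d_{N−2j+1}μ² + μ²)`, `a_0 = 0`. -/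
noncomputable def aSeq (μ : ℝ) (N : ℕ) : ℕ → ℝ
  | 0 => 0
  | j + 1 =>
      (2 * ((N : ℝ) - 2 * ((j : ℝ) + 1) + 2) + aSeq μ N j * μ ^ 2) /
        (2 * ((N : ℝ) - 2 * ((j : ℝ) + 1) + 1) * (2 * ((N : ℝ) - 2 * ((j : ℝ) + 1) + 2)) +
          aSeq μ N j * (2 * ((N : ℝ) - 2 * ((j : ℝ) + 1) + 1)) * μ ^ 2 + μ ^ 2)

/-- The recursive sequence `â_j`:
`â_j = μ/(d_{N−2j+1}d_{N−2j+2} + a_{j−1}d_{N−2j+1}μ² + μ²)`, `â_0 = 0`. -/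
noncomputable def ahatSeq (μ : ℝ) (N : ℕ) : ℕ → ℝ
  | 0 => 0
  | j + 1 =>
      μ / (2 * ((N : ℝ) - 2 * ((j : ℝ) + 1) + 1) * (2 * ((N : ℝ) - 2 * ((j : ℝ) + 1) + 2)) +
          aSeq μ N j * (2 * ((N : ℝ) - 2 * ((j : ℝ) + 1) + 1)) * μ ^ 2 + μ ^ 2)

/-- The recursive sequence `b_j`:
`b_j = (d_{2j−1} + b_{j−1}μ²)/(d_{2j}d_{2j−1} + b_{j−1}d_{2j}μ² + μ²)`, `b_0 = 0`. -/
noncomputable def bSeq (μ : ℝ) : ℕ → ℝ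
  | 0 => 0
  | j + 1 =>
      (2 * (2 * ((j : ℝ) + 1) - 1) + bSeq μ j * μ ^ 2) /
        (2 * (2 * ((j : ℝ) + 1)) * (2 * (2 * ((j : ℝ) + 1) - 1)) +
          bSeq μ j * (2 * (2 * ((j : ℝ) + 1))) * μ ^ 2 + μ ^ 2)

/-- The determinant `D = (d_{N−2n+2} + μ² a_{n−1})(d_{N−2n+1} + μ² b_{(N−2n)/2}) + μ²`. -/
noncomputable def Dden (μ : ℝ) (N n : ℕ) : ℝ :=
  (2 * (((N - 2 * n : ℕ) : ℝ) + 2) + μ ^ 2 * aSeq μ N (n - 1)) *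
      (2 * (((N - 2 * n : ℕ) : ℝ) + 1) + μ ^ 2 * bSeq μ ((N - 2 * n) / 2)) + μ ^ 2

/-- The `2 × 2` matrix `Ĩ = (1/D)·[[d_{N−2n+2} + μ² a_{n−1}, μ], [−μ, d_{N−2n+1} + μ² b_{(N−2n)/2}]]`. -/
noncomputable def Itil (μ : ℝ) (N n : ℕ) : Matrix (Fin 2) (Fin 2) ℝ :=
  !![(2 * (((N - 2 * n : ℕ) : ℝ) + 2) + μ ^ 2 * aSeq μ N (n - 1)) / Dden μ N n,
      μ / Dden μ N n;
     -μ / Dden μ N n,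
      (2 * (((N - 2 * n : ℕ) : ℝ) + 1) + μ ^ 2 * bSeq μ ((N - 2 * n) / 2)) / Dden μ N n]

lemma aSeq_den_pos {μ : ℝ} (hμ : 0 < μ) {u a : ℝ} (hu : 0 < u) (ha : 0 ≤ a) :
    0 < 2 * u * (2 * (u + 1)) + a * (2 * u) * μ ^ 2 + μ ^ 2 := by
  positivity

lemma aSeq_succ (μ : ℝ) (r j : ℕ) :
    aSeq μ (2 * (r + (j + 1))) (j + 1) =
      (2 * ((2 * r + 1 : ℝ) + 1) + aSeq μ (2 * (r + (j + 1))) j * μ ^ 2) /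
        (2 * (2 * r + 1 : ℝ) * (2 * ((2 * r + 1 : ℝ) + 1)) +
          aSeq μ (2 * (r + (j + 1))) j * (2 * (2 * r + 1 : ℝ)) * μ ^ 2 + μ ^ 2) := by
  rw [aSeq]
  push_cast
  ring_nf

lemma ahatSeq_succ (μ : ℝ) (r j : ℕ) :
    ahatSeq μ (2 * (r + (j + 1))) (j + 1) =
      μ / (2 * (2 * r + 1 : ℝ) * (2 * ((2 * r + 1 : ℝ) + 1)) +
          aSeq μ (2 * (r + (j + 1))) j * (2 * (2 * r + 1 : ℝ)) * μ ^ 2 + μ ^ 2) := by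
  rw [ahatSeq]
  push_cast
  ring_nf

lemma aSeq_nonneg {μ : ℝ} (hμ : 0 < μ) (j : ℕ) : ∀ r : ℕ, 0 ≤ aSeq μ (2 * (r + j)) j := by
  induction j with
  | zero => intro r; simp [aSeq]
  | succ j ih =>
    intro r
    have h := ih (r + 1)
    rw [show r + 1 + j = r + (j + 1) by ring] at h
    rw [aSeq_succ]
    positivity

lemma ahatSeq_nonneg {μ : ℝ} (hμ : 0 < μ) (j r : ℕ) : 0 ≤ ahatSeq μ (2 * (r + j)) j := by
  cases j with
  | zero => simp [ahatSeq]
  | succ j =>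
    have h := aSeq_nonneg hμ j (r + 1)
    rw [show r + 1 + j = r + (j + 1) by ring] at h
    rw [ahatSeq_succ]
    positivity

lemma bSeq_succ (μ : ℝ) (j : ℕ) :
    bSeq μ (j + 1) =
      (2 * (2 * j + 1 : ℝ) + bSeq μ j * μ ^ 2) /
        (2 * (2 * j + 2 : ℝ) * (2 * (2 * j + 1 : ℝ)) +
          bSeq μ j * (2 * (2 * j + 2 : ℝ)) * μ ^ 2 + μ ^ 2) := by
  rw [bSeq]
  ring_nf

lemma bSeq_nonneg {μ : ℝ} (hμ : 0 < μ) (j : ℕ) : 0 ≤ bSeq μ j := by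
  induction j with
  | zero => simp [bSeq]
  | succ j ih => rw [bSeq_succ]; positivity

/-- A solution of the three-term recurrence on the last `2 * j` rows is determined by the entry
preceding them. -/
lemma trailing_block {μ : ℝ} (hμ : 0 < μ) {z : ℕ → ℝ} (j : ℕ) : ∀ r : ℕ,
    z (2 * (r + j) + 1) = 0 →
    (∀ k, 2 * r ≤ k → k < 2 * (r + j) →
      μ * z k + 2 * ((k : ℝ) + 1) * z (k + 1) - μ * z (k + 2) = 0) →
    z (2 * r + 1) = -(μ * aSeq μ (2 * (r + j)) j * z (2 * r)) ∧
      (0 < j → z (2 * r + 2) = μ * ahatSeq μ (2 * (r + j)) j * z (2 * r)) := by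
  induction j with
  | zero => intro r h0 _; simpa [aSeq] using h0
  | succ j ih =>
    intro r h0 hz
    have hi := (ih (r + 1) (by rwa [show r + 1 + j = r + (j + 1) by ring])
      (fun k h1 h2 => hz k (by omega) (by omega))).1
    have ha := aSeq_nonneg hμ j (r + 1)
    rw [show r + 1 + j = r + (j + 1) by ring] at hi ha
    rw [show 2 * (r + 1) + 1 = 2 * r + 3 by ring, show 2 * (r + 1) = 2 * r + 2 by ring] at hi
    have e1 := hz (2 * r) le_rfl (by omega)
    have e2 := hz (2 * r + 1) (by omega) (by omega)
    rw [show 2 * r + 1 + 1 = 2 * r + 2 by ring, show 2 * r + 1 + 2 = 2 * r + 3 by ring, hi] at e2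
    push_cast at e1 e2
    rw [aSeq_succ, ahatSeq_succ]
    have hD := aSeq_den_pos hμ (u := 2 * r + 1) (by positivity) ha
    generalize aSeq μ (2 * (r + (j + 1))) j = a at *
    generalize z (2 * r) = x at *
    generalize z (2 * r + 1) = y at *
    generalize z (2 * r + 2) = w at *
    refine ⟨?_, fun _ => ?_⟩
    · rw [mul_div_assoc', div_mul_eq_mul_div, ← neg_div, eq_div_iff hD.ne']
      linear_combination (2 * (2 * r + 1 + 1) + a * μ ^ 2) * e1 + μ * e2
    · rw [mul_div_assoc', div_mul_eq_mul_div, eq_div_iff hD.ne']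
      linear_combination (-μ) * e1 + 2 * (2 * r + 1 : ℝ) * e2

/-- A solution of the three-term recurrence on the first `2 * j` rows is determined by the entry
following them. -/
lemma leading_block {μ : ℝ} (hμ : 0 < μ) {z : ℕ → ℝ} (h0 : z 0 = 0) (j : ℕ)
    (hz : ∀ k, k < 2 * j → μ * z k + 2 * ((k : ℝ) + 1) * z (k + 1) - μ * z (k + 2) = 0) :
    z (2 * j) = μ * bSeq μ j * z (2 * j + 1) := by
  induction j with
  | zero => simpa [bSeq] using h0
  | succ j ih =>
    have hi := ih (fun k hk => hz k (by omega))
    have hb := bSeq_nonneg hμ j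
    have e1 := hz (2 * j) (by omega)
    have e2 := hz (2 * j + 1) (by omega)
    rw [hi] at e1
    rw [show 2 * j + 1 + 1 = 2 * j + 2 by ring, show 2 * j + 1 + 2 = 2 * j + 3 by ring] at e2
    rw [show 2 * (j + 1) + 1 = 2 * j + 3 by ring, show 2 * (j + 1) = 2 * j + 2 by ring, bSeq_succ]
    push_cast at e1 e2
    rw [mul_div_assoc', div_mul_eq_mul_div, eq_div_iff (by positivity)]
    linear_combination (-μ) * e1 + (2 * (2 * j + 1 : ℝ) + bSeq μ j * μ ^ 2) * e2

lemma sum_abs_trailing_block {μ : ℝ} (hμ : 0 < μ) {z : ℕ → ℝ} (j : ℕ) : ∀ r : ℕ,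
    z (2 * (r + j) + 1) = 0 →
    (∀ k, 2 * r ≤ k → k < 2 * (r + j) →
      μ * z k + 2 * ((k : ℝ) + 1) * z (k + 1) - μ * z (k + 2) = 0) →
    ∑ i ∈ Finset.range (2 * j), |z (2 * r + 1 + i)| =
      ∑ i ∈ Finset.range j, μ ^ (i + 1) *
        (aSeq μ (2 * (r + j)) (j - i) + ahatSeq μ (2 * (r + j)) (j - i)) *
        (∏ p ∈ Finset.range i, ahatSeq μ (2 * (r + j)) (j - p)) * |z (2 * r)| := by
  induction j with
  | zero => intro r _ _; simp
  | succ j ih =>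
    intro r h0 hz
    have hi := ih (r + 1) (by rwa [show r + 1 + j = r + (j + 1) by ring])
      (fun k h1 h2 => hz k (by omega) (by omega))
    obtain ⟨h1, h2⟩ := trailing_block hμ (j + 1) r h0 hz
    have h2 := h2 j.succ_pos
    have ha := aSeq_nonneg hμ (j + 1) r
    have hh := ahatSeq_nonneg hμ (j + 1) r
    rw [show r + 1 + j = r + (j + 1) by ring, show 2 * (r + 1) = 2 * r + 2 by ring] at hi
    rw [show 2 * (j + 1) = 2 * j + 1 + 1 by ring, Finset.sum_range_succ', Finset.sum_range_succ',
      Finset.sum_range_succ' _ j]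
    have hL : ∑ i ∈ Finset.range (2 * j), |z (2 * r + 1 + (i + 1 + 1))| =
        ∑ i ∈ Finset.range (2 * j), |z (2 * r + 2 + 1 + i)| :=
      Finset.sum_congr rfl fun i _ => by congr 2; ring
    have hx : |z (2 * r + 2)| = μ * ahatSeq μ (2 * (r + (j + 1))) (j + 1) * |z (2 * r)| := by
      rw [h2, abs_mul, abs_of_nonneg (by positivity)]
    have hy : |z (2 * r + 1)| = μ * aSeq μ (2 * (r + (j + 1))) (j + 1) * |z (2 * r)| := by
      rw [h1, abs_neg, abs_mul, abs_of_nonneg (by positivity)]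
    rw [hL, hi, add_assoc]
    congr 1
    · refine Finset.sum_congr rfl fun i _ => ?_
      rw [Finset.prod_range_succ', hx]
      simp only [Nat.add_sub_add_right, Nat.sub_zero]
      ring
    · simp only [add_zero, zero_add, Finset.range_zero, Finset.prod_empty, Nat.sub_zero, pow_one]
      rw [hy, show 2 * r + 1 + 1 = 2 * r + 2 by ring, hx]
      ring

lemma Tmat_mulVec (N : ℕ) (μ : ℝ) (z : ℕ → ℝ) (h0 : z 0 = 0) (hN : z (N + 1) = 0) (i : Fin N) :
    (Tmat N μ).mulVec (fun j => z (j + 1)) i =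
      μ * z i + 2 * ((i : ℝ) + 1) * z (i + 1) - μ * z (i + 2) := by
  obtain ⟨i, hi⟩ := i
  simp only [Matrix.mulVec, dotProduct, Tmat, Matrix.of_apply]
  rw [Fin.sum_univ_eq_sum_range (fun j => (if i = j then 2 * ((i : ℝ) + 1)
    else if i = j + 1 then μ else if j = i + 1 then -μ else 0) * z (j + 1)) N]
  have hsplit : ∀ j, (if i = j then 2 * ((i : ℝ) + 1)
      else if i = j + 1 then μ else if j = i + 1 then -μ else 0) * z (j + 1) =
      (if i = j then 2 * ((i : ℝ) + 1) * z (j + 1) else 0) +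
      (if i = j + 1 then μ * z (j + 1) else 0) +
      (if i + 1 = j then -μ * z (j + 1) else 0) := by
    intro j
    split_ifs <;> first | omega | simp
  simp only [hsplit, Finset.sum_add_distrib, Finset.sum_ite_eq, Finset.mem_range, hi, if_true]
  have hsub : ∑ j ∈ Finset.range N, (if i = j + 1 then μ * z (j + 1) else 0) = μ * z i := by
    cases i with
    | zero => simp [h0]
    | succ i => simp [show i < N by omega]
  have hsup : (if i + 1 < N then -μ * z (i + 1 + 1) else 0) = -μ * z (i + 2) := by
    split_ifs with h
    · rfl
    · rw [show i + 2 = N + 1 by omega, hN, mul_zero]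
  rw [hsub, hsup]
  ring

lemma Tmat_add_transpose (N : ℕ) (μ : ℝ) :
    Tmat N μ + (Tmat N μ).transpose = Matrix.diagonal fun i : Fin N => 4 * ((i : ℝ) + 1) := by
  ext i j
  simp only [Tmat, Matrix.add_apply, Matrix.transpose_apply, Matrix.of_apply,
    Matrix.diagonal_apply, Fin.ext_iff]
  by_cases h : (i : ℕ) = j
  · simp only [h, if_true]; ring
  · simp only [h, Ne.symm h, if_false]
    split_ifs <;> first | omega | simp

lemma isUnit_det_Tmat (N : ℕ) (μ : ℝ) : IsUnit (Tmat N μ).det := by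
  rw [isUnit_iff_ne_zero]
  intro hdet
  obtain ⟨v, hv, hTv⟩ := Matrix.exists_mulVec_eq_zero_iff.mpr hdet
  have hq : v ⬝ᵥ ((Tmat N μ + (Tmat N μ).transpose).mulVec v) = 0 := by
    rw [Matrix.add_mulVec, dotProduct_add, hTv, Matrix.mulVec_transpose, dotProduct_comm v
      (Matrix.vecMul _ _), ← Matrix.dotProduct_mulVec, hTv]
    simp
  rw [Tmat_add_transpose] at hq
  simp only [dotProduct, Matrix.mulVec_diagonal] at hq
  rw [Finset.sum_eq_zero_iff_of_nonneg] at hq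
  · refine hv (funext fun i => ?_)
    have h := hq i (Finset.mem_univ i)
    have hi : (4 * ((i : ℝ) + 1)) ≠ 0 := by positivity
    simpa [hi] using h
  · intro i _
    nlinarith [mul_self_nonneg (v i), mul_nonneg (Nat.cast_nonneg (α := ℝ) i)
      (mul_self_nonneg (v i))]

/-- The columns of `T_N(μ)⁻¹`, shifted by one and padded with zeros, solve the three-term
recurrence with a unit source. -/
lemma exists_Tmat_inv_col (N : ℕ) (μ : ℝ) (q : Fin N) : ∃ z : ℕ → ℝ,
    z 0 = 0 ∧ z (N + 1) = 0 ∧ (∀ i : Fin N, (Tmat N μ)⁻¹ i q = z (i + 1)) ∧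
    ∀ k, k < N → μ * z k + 2 * ((k : ℝ) + 1) * z (k + 1) - μ * z (k + 2) =
      if k = q then 1 else 0 := by
  let z : ℕ → ℝ
    | 0 => 0
    | k + 1 => if h : k < N then (Tmat N μ)⁻¹ ⟨k, h⟩ q else 0
  have h0 : z 0 = 0 := rfl
  have hN : z (N + 1) = 0 := by simp [z]
  have hz : ∀ i : Fin N, (Tmat N μ)⁻¹ i q = z (i + 1) := fun i => by simp [z]
  refine ⟨z, h0, hN, hz, fun k hk => ?_⟩
  rw [← Tmat_mulVec N μ z h0 hN ⟨k, hk⟩]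
  have h := congrFun (congrFun (Matrix.mul_nonsing_inv _ (isUnit_det_Tmat N μ)) ⟨k, hk⟩) q
  rw [Matrix.mul_apply, Matrix.one_apply] at h
  simp only [Fin.ext_iff] at h
  rw [← h]
  simp only [Matrix.mulVec, dotProduct, hz]

/-- The `2 × 2` system satisfied by the two central entries, solved by Cramer's rule. -/
lemma eq_div_of_two_by_two {p q μ x y s t : ℝ} (hD : q * p + μ ^ 2 ≠ 0)
    (h1 : p * x - μ * y = s) (h2 : μ * x + q * y = t) :
    x = (q * s + μ * t) / (q * p + μ ^ 2) ∧ y = (-μ * s + p * t) / (q * p + μ ^ 2) := by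
  constructor
  · rw [eq_div_iff hD]; linear_combination q * h1 + μ * h2
  · rw [eq_div_iff hD]; linear_combination -μ * h1 + p * h2

/-- Explicit formula for the ℓ¹-sums of the lower parts of the columns
`N−2n+1, N−2n+2` (1-based) of `T_N(μ)⁻¹`:
`Σ_{i=N−2n+1}^{N} |(T_N(μ)⁻¹)_{i,N−2n+c}|
   = ‖Ĩ_{col(c)}‖₁ + Σ_{i=1}^{n−1} μ^i (a_{n−i} + â_{n−i}) (∏_{p=1}^{i−1} â_{n−p}) |Ĩ_{2,c}|`,
where the sum on the right is empty for `n = 1`. -/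
theorem stmt8 (μ : ℝ) (hμ : 0 < μ) (N : ℕ) (hN : 2 ≤ N) (hNe : Even N)
    (n : ℕ) (hn1 : 1 ≤ n) (hn2 : n ≤ N / 2) (c : Fin 2) :
    ∑ i : Fin (2 * n),
        |(Tmat N μ)⁻¹ ⟨N - 2 * n + (i : ℕ), by have := i.isLt; omega⟩
            ⟨N - 2 * n + (c : ℕ), by have := c.isLt; omega⟩|
      = (|Itil μ N n 0 c| + |Itil μ N n 1 c|) +
        ∑ i ∈ Finset.range (n - 1),
          μ ^ (i + 1) * (aSeq μ N (n - i - 1) + ahatSeq μ N (n - i - 1)) *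
            (∏ p ∈ Finset.range i, ahatSeq μ N (n - p - 1)) * |Itil μ N n 1 c| := by
  obtain ⟨M, rfl⟩ := hNe.two_dvd
  obtain ⟨j, rfl⟩ := Nat.exists_eq_add_of_le' hn1
  obtain ⟨m, rfl⟩ := Nat.exists_eq_add_of_le' (show j + 1 ≤ M by omega)
  have hm : 2 * (m + (j + 1)) - 2 * (j + 1) = 2 * m := by omega
  obtain ⟨z, h0, hz1, hcol, hz⟩ := exists_Tmat_inv_col (2 * (m + (j + 1))) μ
    ⟨2 * (m + (j + 1)) - 2 * (j + 1) + (c : ℕ), by have := c.isLt; omega⟩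
  simp only [hcol]
  simp only [hm] at hz ⊢
  have hmj : m + (j + 1) = m + 1 + j := by ring
  have hc := c.isLt
  have hzero : ∀ k, 2 * (m + 1) ≤ k → k < 2 * (m + 1 + j) →
      μ * z k + 2 * ((k : ℝ) + 1) * z (k + 1) - μ * z (k + 2) = 0 := fun k h1 h2 => by
    rw [hz k (by omega), if_neg (by omega)]
  have hz1' : z (2 * (m + 1 + j) + 1) = 0 := by rwa [← hmj]
  have htr := (trailing_block hμ j (m + 1) hz1' hzero).1
  have hsum := sum_abs_trailing_block hμ j (m + 1) hz1' hzero
  have hlead := leading_block hμ h0 m fun k hk => by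
    rw [hz k (by omega), if_neg (by omega)]
  have ha := aSeq_nonneg hμ j (m + 1)
  have hb := bSeq_nonneg hμ m
  rw [← hmj] at htr hsum ha
  rw [show 2 * (m + 1) = 2 * m + 2 by ring] at htr hsum
  have e1 := hz (2 * m) (by omega)
  have e2 := hz (2 * m + 1) (by omega)
  rw [hlead] at e1
  rw [show 2 * m + 1 + 1 = 2 * m + 2 by ring, show 2 * m + 1 + 2 = 2 * m + 2 + 1 by ring,
    htr] at e2
  push_cast at e1 e2
  have hD : Dden μ (2 * (m + (j + 1))) (j + 1) =
      (2 * ((2 * m : ℝ) + 2) + μ ^ 2 * aSeq μ (2 * (m + (j + 1))) j) *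
        (2 * ((2 * m : ℝ) + 1) + μ ^ 2 * bSeq μ m) + μ ^ 2 := by
    simp [Dden, hm]
  have hDpos : 0 < Dden μ (2 * (m + (j + 1))) (j + 1) := by rw [hD]; positivity
  obtain ⟨hx, hy⟩ := eq_div_of_two_by_two (x := z (2 * m + 1)) (y := z (2 * m + 2))
    (s := if 2 * m = 2 * m + (c : ℕ) then 1 else 0)
    (t := if 2 * m + 1 = 2 * m + (c : ℕ) then 1 else 0)
    (hD ▸ hDpos.ne') (by linear_combination e1) (by linear_combination e2)
  rw [← hD] at hx hy
  have hI0 : Itil μ (2 * (m + (j + 1))) (j + 1) 0 c = z (2 * m + 1) := by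
    rw [hx]
    fin_cases c <;> simp [Itil, hm]
  have hI1 : Itil μ (2 * (m + (j + 1))) (j + 1) 1 c = z (2 * m + 2) := by
    rw [hy]
    fin_cases c <;> simp [Itil, hm]
  rw [hI0, hI1, Fin.sum_univ_eq_sum_range (fun i => |z (2 * m + i + 1)|) (2 * (j + 1)),
    show 2 * (j + 1) = 2 * j + 1 + 1 by ring, Finset.sum_range_succ', Finset.sum_range_succ']
  have hL : ∑ i ∈ Finset.range (2 * j), |z (2 * m + (i + 1 + 1) + 1)| =
      ∑ i ∈ Finset.range (2 * j), |z (2 * m + 2 + 1 + i)| :=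
    Finset.sum_congr rfl fun i _ => by congr 2; ring
  have hidx : ∀ i, j + 1 - i - 1 = j - i := fun i => by omega
  simp only [hidx, Nat.add_sub_cancel]
  rw [hL, hsum, zero_add, add_zero]
  ring
end

section
/- Let N be an even integer with N > 2μ. Then the inverse of L^{(N)}_μ satisfies: ‖(L^{(N)}_μ)⁻¹‖_{B(ℓ¹)} ≤ 1.612 + 0.1 if 10 < μ ≤ 100; ‖(L^{(N)}_μ)⁻¹‖_{B(ℓ¹)} ≤ 1.472 + 0.01 if 100 < μ ≤ 1000; and ‖(L^{(N)}_μ)⁻¹‖_{B(ℓ¹)} ≤ 1.454 + 0.001 if μ > 1000. The bounds are uniform with respect to the even approximation dimension N. -/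
/-- The `(N+1) × (N+1)` matrix `L^{(N)}_μ`: first row `(1, −2, 2, −2, …)`, first column
`(1, μ, 0, …, 0)ᵀ`, and bottom-right `N × N` block equal to `T_N(μ)` (0-based indexing). -/
noncomputable def Lmat (N : ℕ) (μ : ℝ) : Matrix (Fin (N + 1)) (Fin (N + 1)) ℝ :=
  Matrix.of fun i j =>
    if (i : ℕ) = 0 then (if (j : ℕ) = 0 then 1 else 2 * (-1 : ℝ) ^ (j : ℕ))
    else if (j : ℕ) = 0 then (if (i : ℕ) = 1 then μ else 0)
    else if (i : ℕ) = (j : ℕ) then 2 * ((i : ℕ) : ℝ)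
    else if (i : ℕ) = (j : ℕ) + 1 then μ
    else if (j : ℕ) = (i : ℕ) + 1 then -μ
    else 0

/-- The weighted ℓ¹ norm of a vector in `ℝ^{N+1}`: `‖v‖ = |v_1| + 2 Σ_{j=2}^{N+1} |v_j|`. -/
noncomputable def vecl1 {N : ℕ} (v : Fin (N + 1) → ℝ) : ℝ :=
  |v 0| + 2 * ∑ j : Fin N, |v j.succ|

/-- The `B(ℓ¹)` operator norm of an `(N+1) × (N+1)` matrix:
`max { |A_{1,1}| + 2 Σ_{j≥2} |A_{j,1}| , max_{n≥2} ( (1/2)|A_{1,n}| + Σ_{j≥2} |A_{j,n}| ) }`. -/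
noncomputable def matBl1 {N : ℕ} (A : Matrix (Fin (N + 1)) (Fin (N + 1)) ℝ) : ℝ :=
  max (|A 0 0| + 2 * ∑ j : Fin N, |A j.succ 0|)
    (⨆ n : Fin N, ((1 / 2) * |A 0 n.succ| + ∑ j : Fin N, |A j.succ n.succ|))

/-- The solution of `x_{k+2} = x_k + c_k x_{k+1}` with `x_0 = 0` and `x_1 = 1`. -/
noncomputable def threeTermSol (c : ℕ → ℝ) : ℕ → ℝ
  | 0 => 0
  | 1 => 1
  | k + 2 => threeTermSol c k + c k * threeTermSol c (k + 1)

lemma threeTermSol_nonneg_and_succ_pos {c : ℕ → ℝ} (hc : ∀ k, 0 < c k) (k : ℕ) :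
    0 ≤ threeTermSol c k ∧ 0 < threeTermSol c (k + 1) := by
  induction k with
  | zero => simp [threeTermSol]
  | succ k ih =>
    refine ⟨ih.2.le, ?_⟩
    have := mul_pos (hc k) ih.2
    rw [threeTermSol]
    linarith [ih.1]

/-- The solution of the homogeneous recurrence which vanishes at `0` is positive. -/
lemma exists_forward_solution {μ : ℝ} (hμ : 0 < μ) :
    ∃ p : ℕ → ℝ, p 0 = 0 ∧ (∀ k, 0 < p (k + 1)) ∧
      ∀ k : ℕ, μ * p (k + 2) = μ * p k + 2 * (k + 1) * p (k + 1) := by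
  have hc : ∀ k : ℕ, 0 < 2 * ((k : ℝ) + 1) / μ := fun k => by positivity
  refine ⟨threeTermSol fun k => 2 * ((k : ℝ) + 1) / μ, rfl,
    fun k => (threeTermSol_nonneg_and_succ_pos hc k).2, fun k => ?_⟩
  rw [threeTermSol]
  field_simp

/-- The solution of the sign-reversed homogeneous recurrence which vanishes at `N + 1` is
positive below `N + 1`. -/
lemma exists_backward_solution {μ : ℝ} (hμ : 0 < μ) (N : ℕ) :
    ∃ y : ℕ → ℝ, y (N + 1) = 0 ∧ (∀ i ≤ N, 0 < y i) ∧
      ∀ i < N, μ * y i = μ * y (i + 2) + 2 * (i + 1) * y (i + 1) := by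
  set c : ℕ → ℝ := fun k => if k < N then 2 * ((N - k : ℕ) : ℝ) / μ else 1 with hcdef
  have hc : ∀ k, 0 < c k := fun k => by
    simp only [hcdef]
    split_ifs with h
    · have : (0 : ℝ) < ((N - k : ℕ) : ℝ) := by exact_mod_cast Nat.sub_pos_of_lt h
      positivity
    · exact one_pos
  refine ⟨fun i => threeTermSol c (N + 1 - i), by simp [threeTermSol], fun i hi => ?_,
    fun i hi => ?_⟩
  · have := (threeTermSol_nonneg_and_succ_pos hc (N - i)).2
    rwa [show N - i + 1 = N + 1 - i by omega] at this
  · obtain ⟨k, rfl⟩ := Nat.exists_eq_add_of_lt hi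
    have h0 : i + k + 1 + 1 - i = k + 2 := by omega
    have h1 : i + k + 1 + 1 - (i + 1) = k + 1 := by omega
    have h2 : i + k + 1 + 1 - (i + 2) = k := by omega
    have h3 : c k = 2 * ((i : ℝ) + 1) / μ := by
      simp only [hcdef]
      rw [if_pos (by omega), show i + k + 1 - k = i + 1 by omega]
      push_cast
      rfl
    simp only [h0, h1, h2]
    rw [threeTermSol, h3]
    field_simp

/-- Since `μ ≤ N`, the backward solution decays at the rate `1 + i / μ`. -/
lemma backward_solution_decay {μ : ℝ} (hμ : 0 < μ) {N : ℕ} (hN : μ ≤ N) {y : ℕ → ℝ}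
    (hend : y (N + 1) = 0) (hpos : ∀ i ≤ N, 0 < y i)
    (hrec : ∀ i < N, μ * y i = μ * y (i + 2) + 2 * (i + 1) * y (i + 1)) :
    ∀ i ≤ N, (μ + i) * y (i + 1) ≤ μ * y i := by
  suffices h : ∀ k i : ℕ, N ≤ i + k → i ≤ N → (μ + i) * y (i + 1) ≤ μ * y i from
    fun i hi => h N i (by omega) hi
  intro k
  induction k using Nat.strong_induction_on with
  | _ k ih =>
    intro i hk hi
    rcases hi.eq_or_lt with rfl | hlt
    · rw [hend]
      have := mul_pos hμ (hpos i le_rfl)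
      linarith
    · have hy2 : 0 ≤ y (i + 2) := by
        rcases Nat.lt_or_ge (i + 1) N with h | h
        · exact (hpos _ h).le
        · rw [show i + 2 = N + 1 by omega, hend]
      have hy1 := hpos (i + 1) hlt
      have hr := hrec i hlt
      rcases le_or_gt μ ((i : ℝ) + 2) with hle | hgt
      · nlinarith [mul_nonneg (sub_nonneg.2 hle) hy1.le, mul_nonneg hμ.le hy2]
      · have hiN : i + 2 ≤ N := by
          have : (i : ℝ) + 2 < N := lt_of_lt_of_le hgt hN
          exact_mod_cast this.le
        have h3 := ih (k - 2) (by omega) (i + 2) (by omega) hiN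
        have hr1 := hrec (i + 1) hiN
        have hy2' := hpos _ hiN
        push_cast at h3 hr1
        set x : ℝ := (i : ℝ) + 2 with hx
        have hx0 : 0 ≤ x := by positivity
        have e1 : (i : ℝ) + 1 + 1 = x := by rw [hx]; ring
        rw [e1] at hr1
        rw [show i + 1 + 2 = i + 2 + 1 by omega, show i + 1 + 1 = i + 2 by omega] at hr1
        have key : μ * (μ + x) * y (i + 1) ≤ (μ ^ 2 + 2 * x * (μ + x)) * y (i + 2) := by
          nlinarith [mul_le_mul_of_nonneg_left h3 hμ.le]
        have key2 : (μ - x) * y (i + 1) ≤ μ * y (i + 2) := by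
          have hp : 0 < μ * (μ + x) := by positivity
          refine le_of_mul_le_mul_left ?_ hp
          have := mul_le_mul_of_nonneg_left key (sub_nonneg.2 hgt.le)
          have : 0 ≤ x ^ 3 * y (i + 2) := by positivity
          nlinarith
        have : (i : ℝ) = x - 2 := by rw [hx]; ring
        rw [this] at hr ⊢
        nlinarith

/-- Absolute bounds for a nonnegative sequence obeying the modulus relations of a column of
`T_N(μ)⁻¹`. -/
lemma le_inv_of_relations {μ : ℝ} (hμ : 0 < μ) {N n : ℕ} {a : ℕ → ℝ}
    (ha : ∀ i, 0 ≤ a i) (hn0 : 0 < n) (hnN : n ≤ N)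
    (hlow : ∀ i, i + 1 < n → 2 * ((i : ℝ) + 1) * a (i + 1) = μ * (a (i + 2) - a i))
    (hmid : ∀ i, i + 1 = n →
      2 * ((i : ℝ) + 1) * a (i + 1) + μ * a i + μ * a (i + 2) = 1)
    (hupp : ∀ i, n ≤ i → i < N → 2 * ((i : ℝ) + 1) * a (i + 1) = μ * (a i - a (i + 2)))
    (han : μ * a n ≤ 1) : ∀ i ≤ N, μ * a i ≤ 1 := by
  obtain ⟨m, rfl⟩ := Nat.exists_eq_succ_of_ne_zero hn0.ne'
  have hm := hmid m rfl
  have hm1 : 0 ≤ 2 * ((m : ℝ) + 1) * a (m + 1) := mul_nonneg (by positivity) (ha _)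
  have hup : ∀ k, m + 1 + k < N + 1 → μ * a (m + 1 + k) ≤ 1 ∧ μ * a (m + 1 + (k + 1)) ≤ 1 := by
    intro k
    induction k with
    | zero =>
      intro _
      refine ⟨han, ?_⟩
      have := mul_nonneg hμ.le (ha m)
      rw [show m + 1 + (0 + 1) = m + 2 by omega]
      linarith
    | succ k ih =>
      intro hk
      have h := ih (by omega)
      refine ⟨h.2, ?_⟩
      have hu := hupp (m + 1 + k) (by omega) (by omega)
      have := mul_nonneg (show 0 ≤ 2 * (((m + 1 + k : ℕ) : ℝ) + 1) by positivity)
        (ha (m + 1 + k + 1))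
      rw [show m + 1 + (k + 1 + 1) = m + 1 + k + 2 by omega]
      linarith [h.1]
  have hdown : ∀ k, k ≤ m → μ * a (m - k) ≤ 1 ∧ μ * a (m - k + 1) ≤ 1 := by
    intro k
    induction k with
    | zero =>
      intro _
      refine ⟨?_, han⟩
      have := mul_nonneg hμ.le (ha (m + 2))
      rw [Nat.sub_zero]
      linarith
    | succ k ih =>
      intro hk
      have h := ih (by omega)
      obtain ⟨j, hj⟩ : ∃ j, m - k = j + 1 := ⟨m - k - 1, by omega⟩
      rw [show m - (k + 1) = j by omega]
      rw [hj] at h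
      refine ⟨?_, h.1⟩
      have hu := hlow j (by omega)
      have := mul_nonneg (show 0 ≤ 2 * ((j : ℝ) + 1) by positivity) (ha (j + 1))
      linarith [h.2]
  intro i hi
  rcases Nat.lt_or_ge m i with h | h
  · have := (hup (i - (m + 1)) (by omega)).1
    rwa [show m + 1 + (i - (m + 1)) = i by omega] at this
  · have := (hdown (m - i) (by omega)).1
    rwa [show m - (m - i) = i by omega] at this

/-- Weighted summation of the modulus relations by telescoping. -/
lemma weighted_sum_le_of_relations {μ : ℝ} (hμ : 0 < μ) {N n : ℕ} {a : ℕ → ℝ}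
    (ha : ∀ i, 0 ≤ a i) (hn0 : 0 < n) (hnN : n ≤ N)
    (hlow : ∀ i, i + 1 < n → 2 * ((i : ℝ) + 1) * a (i + 1) = μ * (a (i + 2) - a i))
    (hmid : ∀ i, i + 1 = n →
      2 * ((i : ℝ) + 1) * a (i + 1) + μ * a i + μ * a (i + 2) = 1)
    (hupp : ∀ i, n ≤ i → i < N → 2 * ((i : ℝ) + 1) * a (i + 1) = μ * (a i - a (i + 2)))
    (han : μ * a n ≤ 1) :
    ∑ i ∈ Finset.range N, 2 * ((i : ℝ) + 1) * a (i + 1) ≤ 3 := by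
  have key : ∀ k ≤ N, (k < n → ∑ i ∈ Finset.range k, 2 * ((i : ℝ) + 1) * a (i + 1) ≤
        μ * (a (k + 1) + a k)) ∧
      (n ≤ k → ∑ i ∈ Finset.range k, 2 * ((i : ℝ) + 1) * a (i + 1) ≤
        1 + 2 * (μ * a n) - μ * (a k + a (k + 1))) := by
    intro k
    induction k with
    | zero =>
      refine fun _ => ⟨fun _ => ?_, fun h => by omega⟩
      simpa using mul_nonneg hμ.le (add_nonneg (ha 1) (ha 0))
    | succ k ih =>
      intro hk
      obtain ⟨h1, h2⟩ := ih (by omega)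
      rw [Finset.sum_range_succ]
      refine ⟨fun h => ?_, fun h => ?_⟩
      · linarith [h1 (by omega), hlow k h]
      · rcases h.eq_or_lt with h | h
        · subst h
          linarith [h1 (by omega), hmid k rfl]
        · linarith [h2 (by omega), hupp k (by omega) (by omega)]
  have h := (key N le_rfl).2 hnN
  have := mul_nonneg hμ.le (add_nonneg (ha N) (ha (N + 1)))
  linarith

/-- A nonnegative sequence which is bounded by `1 / 10` and has weighted sum at most `3` has sum
at most `7 / 10`. -/
lemma sum_le_of_weighted_sum_le {N : ℕ} {a : ℕ → ℝ} (ha : ∀ i, 0 ≤ a i)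
    (hle : ∀ i ≤ N, a i ≤ 1 / 10)
    (hw : ∑ i ∈ Finset.range N, 2 * ((i : ℝ) + 1) * a (i + 1) ≤ 3) :
    ∑ i ∈ Finset.range N, a (i + 1) ≤ 7 / 10 := by
  have h1 : ∀ i ∈ Finset.range N, a (i + 1) ≤
      (if i ∈ Finset.range 4 then 1 / 10 else 0) +
        1 / 10 * (2 * ((i : ℝ) + 1) * a (i + 1)) := by
    intro i hi
    have h0 := ha (i + 1)
    split_ifs with h
    · have := hle (i + 1) (Finset.mem_range.1 hi)
      have : 0 ≤ 2 * ((i : ℝ) + 1) * a (i + 1) := by positivity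
      linarith
    · have : (4 : ℝ) ≤ i := by
        rw [Finset.mem_range, not_lt] at h
        exact_mod_cast h
      nlinarith
  have h2 : ∑ i ∈ Finset.range N, (if i ∈ Finset.range 4 then (1 / 10 : ℝ) else 0) ≤ 4 / 10 := by
    rw [Finset.sum_ite_mem, Finset.sum_const, nsmul_eq_mul]
    have : (Finset.range N ∩ Finset.range 4).card ≤ 4 := by
      simp
    have : ((Finset.range N ∩ Finset.range 4).card : ℝ) ≤ 4 := by exact_mod_cast this
    linarith
  calc _ ≤ _ := Finset.sum_le_sum h1
    _ ≤ 7 / 10 := by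
      rw [Finset.sum_add_distrib, ← Finset.mul_sum]
      linarith

/-- The `n`-th column of `T_N(μ)⁻¹`, extended by zero at both ends, has `ℓ¹` norm at most
`7 / 10`. -/
lemma exists_tridiagonal_column {μ : ℝ} (hμ : 10 ≤ μ) {N n : ℕ} (hN : μ ≤ N) (hn0 : 0 < n)
    (hnN : n ≤ N) :
    ∃ s : ℕ → ℝ, s 0 = 0 ∧ s (N + 1) = 0 ∧
      (∀ i < N, μ * s i + 2 * ((i : ℝ) + 1) * s (i + 1) - μ * s (i + 2) =
        if i + 1 = n then 1 else 0) ∧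
      ∑ i ∈ Finset.range N, |s (i + 1)| ≤ 7 / 10 := by
  have hμ0 : 0 < μ := by linarith
  obtain ⟨p, hp0, hppos, hprec⟩ := exists_forward_solution hμ0
  obtain ⟨y, hyend, hypos, hyrec⟩ := exists_backward_solution hμ0 N
  have hdecay := backward_solution_decay hμ0 hN hyend hypos hyrec
  have hpnn : ∀ i, 0 ≤ p i := by
    rintro (_ | i)
    · exact hp0.ge
    · exact (hppos i).le
  obtain ⟨m, rfl⟩ := Nat.exists_eq_succ_of_ne_zero hn0.ne'
  rw [Nat.succ_eq_add_one] at *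
  have hynn : ∀ i ≤ N + 1, 0 ≤ y i := fun i hi => by
    rcases hi.eq_or_lt with rfl | h
    · exact hyend.ge
    · exact (hypos i (by omega)).le
  have hpm := hppos m
  have hym := hypos (m + 1) hnN
  have hym2 := hynn (m + 2) (by omega)
  set W : ℝ := μ * p m * y (m + 1) + 2 * ((m : ℝ) + 1) * (p (m + 1) * y (m + 1)) +
    μ * p (m + 1) * y (m + 2) with hW
  have hWpos : 0 < W := by
    have := hpnn m
    positivity
  set a : ℕ → ℝ := fun i => if i ≤ m + 1 then p i * y (m + 1) / W else
    if i ≤ N + 1 then p (m + 1) * y i / W else 0 with ha_def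
  have halow : ∀ i ≤ m + 1, a i = p i * y (m + 1) / W := fun i hi => by simp [ha_def, hi]
  have haupp : ∀ i, m + 1 ≤ i → i ≤ N + 1 → a i = p (m + 1) * y i / W := fun i hi hi' => by
    rcases hi.eq_or_lt with rfl | h
    · exact halow _ le_rfl
    · simp [ha_def, hi', not_le.2 h]
  have ha : ∀ i, 0 ≤ a i := fun i => by
    have := hpnn i
    simp only [ha_def]
    split_ifs with h h'
    · positivity
    · have := hynn i h'
      positivity
    · exact le_rfl
  have hlow : ∀ i, i + 1 < m + 1 → 2 * ((i : ℝ) + 1) * a (i + 1) = μ * (a (i + 2) - a i) := by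
    intro i hi
    rw [halow (i + 1) (by omega), halow (i + 2) (by omega), halow i (by omega)]
    have := hprec i
    field_simp
    linear_combination -this
  have hmid : ∀ i, i + 1 = m + 1 →
      2 * ((i : ℝ) + 1) * a (i + 1) + μ * a i + μ * a (i + 2) = 1 := by
    intro i hi
    obtain rfl : i = m := by omega
    rw [halow (i + 1) le_rfl, haupp (i + 2) (by omega) (by omega), halow i (by omega)]
    field_simp
    rw [hW]
    ring
  have hupp : ∀ i, m + 1 ≤ i → i < N →
      2 * ((i : ℝ) + 1) * a (i + 1) = μ * (a i - a (i + 2)) := by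
    intro i hi hiN
    rw [haupp (i + 1) (by omega) (by omega), haupp (i + 2) (by omega) (by omega),
      haupp i (by omega) (by omega)]
    have := hyrec i hiN
    field_simp
    linear_combination -this
  have han : μ * a (m + 1) ≤ 1 := by
    rw [halow _ le_rfl, ← mul_div_assoc, div_le_one hWpos, hW]
    have h1 := hyrec m (by omega)
    have h2 := hdecay m (by omega)
    have h3 : 0 ≤ (m : ℝ) * y (m + 1) := by positivity
    have h4 : 0 ≤ μ * p m * y (m + 1) := by
      have := hpnn m
      positivity
    have h5 : μ * y (m + 1) ≤ 2 * ((m : ℝ) + 1) * y (m + 1) + μ * y (m + 2) := by linarith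
    have := mul_le_mul_of_nonneg_left h5 hpm.le
    linarith
  have hle : ∀ i ≤ N, a i ≤ 1 / 10 := fun i hi => by
    have h1 := le_inv_of_relations hμ0 ha hn0 hnN hlow hmid hupp han i hi
    have := mul_le_mul_of_nonneg_right hμ (ha i)
    linarith
  have hsum := sum_le_of_weighted_sum_le ha hle
    (weighted_sum_le_of_relations hμ0 ha hn0 hnN hlow hmid hupp han)
  set ε : ℕ → ℝ := fun i => if i ≤ m + 1 then 1 else (-1) ^ (i + (m + 1)) with hε
  have hεlow : ∀ i ≤ m + 1, ε i = 1 := fun i hi => by simp [hε, hi]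
  have hεupp : ∀ i, m + 1 ≤ i → ε i = (-1) ^ (i + (m + 1)) := fun i hi => by
    rcases hi.eq_or_lt with rfl | h
    · rw [hεlow _ le_rfl, ← two_mul, pow_mul]
      simp
    · simp [hε, not_le.2 h]
  refine ⟨fun i => ε i * a i, ?_, ?_, fun i hi => ?_, ?_⟩
  · simp [halow 0 (by omega), hp0]
  · simp [haupp (N + 1) (by omega) le_rfl, hyend]
  · beta_reduce
    rcases lt_trichotomy i m with h | rfl | h
    · rw [if_neg (by omega), hεlow _ (by omega), hεlow _ (by omega), hεlow _ (by omega)]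
      linarith [hlow i (by omega)]
    · rw [if_pos rfl, hεlow _ (by omega), hεlow _ (by omega), hεupp _ (by omega),
        show i + 2 + (i + 1) = 2 * (i + 1) + 1 by omega, pow_succ, pow_mul]
      simp only [even_two, Even.neg_pow, one_pow]
      linarith [hmid i rfl]
    · rw [if_neg (by omega), hεupp _ (by omega), hεupp _ (by omega), hεupp _ (by omega),
        show i + 2 + (m + 1) = i + (m + 1) + 2 by omega,
        show i + 1 + (m + 1) = i + (m + 1) + 1 by omega, pow_add _ _ 2, pow_succ _ (i + (m + 1))]
      linear_combination -(-1 : ℝ) ^ (i + (m + 1)) * hupp i h hi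
  · refine le_trans (le_of_eq (Finset.sum_congr rfl fun i _ => ?_)) hsum
    have h1 : |ε (i + 1)| = 1 := by
      simp only [hε]
      split_ifs <;> simp
    rw [abs_mul, h1, one_mul, abs_of_nonneg (ha _)]

/-- The zeroth entry of `L^{(N)}_μ f`. -/
lemma Lmat_mulVec_zero (N : ℕ) (μ : ℝ) (f : ℕ → ℝ) :
    (Lmat N μ).mulVec (fun j => f j) 0 =
      f 0 + ∑ j : Fin N, 2 * (-1 : ℝ) ^ ((j : ℕ) + 1) * f (j + 1) := by
  simp [Matrix.mulVec, dotProduct, Fin.sum_univ_succ, Lmat]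

/-- The remaining entries of `L^{(N)}_μ f`, for `f` vanishing at `N + 1`. -/
lemma Lmat_mulVec_succ (N : ℕ) (μ : ℝ) (f : ℕ → ℝ) (hf : f (N + 1) = 0) (i : Fin N) :
    (Lmat N μ).mulVec (fun j => f j) i.succ =
      μ * f i + 2 * ((i : ℝ) + 1) * f (i + 1) - μ * f (i + 2) := by
  have hterm : ∀ j : Fin (N + 1), Lmat N μ i.succ j * f j =
      (if (j : ℕ) = i then μ * f j else 0) +
        (if (j : ℕ) = (i : ℕ) + 1 then 2 * ((i : ℝ) + 1) * f j else 0) +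
        (if (j : ℕ) = (i : ℕ) + 2 then -μ * f j else 0) := by
    intro j
    simp only [Lmat, Matrix.of_apply, Fin.val_succ]
    split_ifs <;> first | contradiction | omega | (push_cast; ring)
  have hi := i.2
  simp only [Matrix.mulVec, dotProduct, hterm]
  rw [Fin.sum_univ_eq_sum_range (fun j => (if j = (i : ℕ) then μ * f j else 0) +
        (if j = (i : ℕ) + 1 then 2 * ((i : ℝ) + 1) * f j else 0) +
        (if j = (i : ℕ) + 2 then -μ * f j else 0)) (N + 1)]
  simp only [Finset.sum_add_distrib, Finset.sum_ite_eq', Finset.mem_range]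
  rw [if_pos (by omega), if_pos (by omega)]
  split_ifs with h
  · ring
  · rw [show (i : ℕ) + 2 = N + 1 by omega, hf]
    ring

lemma eq_nonsing_inv_mulVec {ι : Type*} [Fintype ι] [DecidableEq ι] {A : Matrix ι ι ℝ}
    (hA : IsUnit A.det) {x v : ι → ℝ} (h : A.mulVec x = v) : A⁻¹.mulVec v = x := by
  rw [← h, Matrix.mulVec_mulVec, Matrix.nonsing_inv_mul _ hA, Matrix.one_mulVec]

/-- The zeroth column of the inverse has weighted `ℓ¹` norm one. -/
lemma vecl1_inv_col_zero {μ : ℝ} (hμ : 0 < μ) {N : ℕ} (hA : IsUnit (Lmat N μ).det) :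
    vecl1 ((Lmat N μ)⁻¹.col 0) = 1 := by
  obtain ⟨y, hyend, hypos, hyrec⟩ := exists_backward_solution hμ N
  have hsum : 0 ≤ ∑ j : Fin N, y (j + 1) :=
    Finset.sum_nonneg fun j _ => (hypos _ (by omega)).le
  set Y : ℝ := y 0 + 2 * ∑ j : Fin N, y (j + 1) with hY
  have hYpos : 0 < Y := by linarith [hypos 0 (by omega)]
  set c : ℕ → ℝ := fun i => (-1) ^ i * (y i / Y) with hc
  have hL : (Lmat N μ).mulVec (fun j => c j) = Pi.single 0 1 := by
    funext i
    refine Fin.cases ?_ (fun i => ?_) i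
    · rw [Lmat_mulVec_zero, Pi.single_eq_same]
      simp only [hc]
      have : ∀ j : Fin N, 2 * (-1 : ℝ) ^ ((j : ℕ) + 1) * ((-1) ^ ((j : ℕ) + 1) * (y (j + 1) / Y)) =
          2 / Y * y (j + 1) := fun j => by
        have : (-1 : ℝ) ^ ((j : ℕ) + 1) * (-1) ^ ((j : ℕ) + 1) = 1 := by
          rw [← mul_pow]; simp
        linear_combination (2 * (y (j + 1) / Y)) * this
      rw [Finset.sum_congr rfl fun j _ => this j, ← Finset.mul_sum]
      field_simp
      rw [hY]
    · rw [Lmat_mulVec_succ _ _ _ (by simp [hc, hyend]), Pi.single_eq_of_ne (Fin.succ_ne_zero i)]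
      simp only [hc, pow_succ]
      have := hyrec i i.2
      field_simp
      linear_combination (-1 : ℝ) ^ (i : ℕ) * this
  have hcol := eq_nonsing_inv_mulVec hA hL
  rw [Matrix.mulVec_single_one] at hcol
  rw [hcol]
  have habs : ∀ i : ℕ, i ≤ N → |c i| = y i / Y := fun i hi => by
    rw [abs_mul, abs_pow, abs_neg, abs_one, one_pow, one_mul,
      abs_of_pos (div_pos (hypos i hi) hYpos)]
  have hs : ∀ j : Fin N, |c (j + 1)| = y (j + 1) / Y := fun j => habs _ j.2
  simp only [vecl1, Fin.val_succ, hs, Fin.val_zero, habs 0 (Nat.zero_le N)]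
  rw [← Finset.sum_div]
  field_simp
  exact hY.symm

/-- The remaining columns of the inverse have weighted `ℓ¹` norm at most `14 / 5`. -/
lemma vecl1_inv_col_succ_le {μ : ℝ} (hμ : 10 ≤ μ) {N : ℕ} (hN : μ ≤ N)
    (hA : IsUnit (Lmat N μ).det) (n : Fin N) :
    vecl1 ((Lmat N μ)⁻¹.col n.succ) ≤ 14 / 5 := by
  obtain ⟨s, hs0, hsend, hsrec, hsum⟩ :=
    exists_tridiagonal_column hμ hN (Nat.succ_pos n) (Nat.succ_le_of_lt n.2)
  rw [← Fin.sum_univ_eq_sum_range (fun i => |s (i + 1)|) N] at hsum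
  set r : ℝ := ∑ j : Fin N, 2 * (-1 : ℝ) ^ ((j : ℕ) + 1) * s (j + 1) with hr
  have hL : (Lmat N μ).mulVec (fun j => s j) = Pi.single n.succ 1 + r • Pi.single 0 1 := by
    funext i
    refine Fin.cases ?_ (fun i => ?_) i
    · rw [Lmat_mulVec_zero, hs0, ← hr]
      simp [(Fin.succ_ne_zero n).symm]
    · rw [Lmat_mulVec_succ _ _ _ hsend, hsrec i i.2]
      simp [Pi.single_apply, Fin.ext_iff]
  have hcol := eq_nonsing_inv_mulVec hA hL
  rw [Matrix.mulVec_add, Matrix.mulVec_smul, Matrix.mulVec_single_one,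
    Matrix.mulVec_single_one] at hcol
  have hentry : ∀ i, (Lmat N μ)⁻¹.col n.succ i = s i - r * (Lmat N μ)⁻¹.col 0 i := fun i => by
    have := congrFun hcol i
    simp only [Pi.add_apply, Pi.smul_apply, smul_eq_mul] at this
    linarith
  have habs : ∀ i, |(Lmat N μ)⁻¹.col n.succ i| ≤ |s i| + |r| * |(Lmat N μ)⁻¹.col 0 i| := fun i => by
    rw [hentry, ← abs_mul]
    exact abs_sub _ _
  have hrle : |r| ≤ 2 * ∑ j : Fin N, |s (j + 1)| := by
    rw [hr, Finset.mul_sum]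
    refine (Finset.abs_sum_le_sum_abs _ _).trans (le_of_eq (Finset.sum_congr rfl fun j _ => ?_))
    simp [abs_mul]
  have h0 := habs 0
  have h1 : ∑ j : Fin N, |(Lmat N μ)⁻¹.col n.succ j.succ| ≤
      ∑ j : Fin N, |s (j + 1)| + |r| * ∑ j : Fin N, |(Lmat N μ)⁻¹.col 0 j.succ| := by
    rw [Finset.mul_sum, ← Finset.sum_add_distrib]
    exact Finset.sum_le_sum fun j _ => habs j.succ
  have h2 := vecl1_inv_col_zero (by linarith) hA
  rw [Fin.val_zero, hs0, abs_zero, zero_add] at h0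
  unfold vecl1 at h2 ⊢
  have h3 : |r| * |(Lmat N μ)⁻¹.col 0 0| + 2 * (|r| * ∑ j : Fin N, |(Lmat N μ)⁻¹.col 0 j.succ|) =
      |r| := by
    linear_combination |r| * h2
  linarith

/-- The operator norm of the inverse is at most `7 / 5`, uniformly in `μ ≥ 10` and `N ≥ μ`. -/
lemma matBl1_inv_le {μ : ℝ} (hμ : 10 ≤ μ) {N : ℕ} (hN : μ ≤ N) :
    matBl1 (Lmat N μ)⁻¹ ≤ 7 / 5 := by
  by_cases hA : IsUnit (Lmat N μ).det
  · refine max_le ?_ (Real.iSup_le (fun n => ?_) (by norm_num))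
    · have := vecl1_inv_col_zero (by linarith) hA
      simp only [vecl1, Matrix.col_apply] at this
      linarith
    · have := vecl1_inv_col_succ_le hμ hN hA n
      simp only [vecl1, Matrix.col_apply] at this
      linarith
  · rw [Matrix.nonsing_inv_apply_not_isUnit _ hA]
    simp [matBl1]
    norm_num

/-- Uniform bounds for `‖(L^{(N)}_μ)⁻¹‖_{B(ℓ¹)}` for large `μ`, for all even `N > 2μ`. -/
theorem stmt15 (μ : ℝ) (N : ℕ) (hNe : Even N) (hN : 2 * μ < (N : ℝ)) :
    (10 < μ → μ ≤ 100 → matBl1 ((Lmat N μ)⁻¹) ≤ 1.612 + 0.1) ∧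
    (100 < μ → μ ≤ 1000 → matBl1 ((Lmat N μ)⁻¹) ≤ 1.472 + 0.01) ∧
    (1000 < μ → matBl1 ((Lmat N μ)⁻¹) ≤ 1.454 + 0.001) := by
  have h : 10 < μ → matBl1 ((Lmat N μ)⁻¹) ≤ 7 / 5 := fun hμ => matBl1_inv_le hμ.le (by linarith)
  refine ⟨fun h1 _ => ?_, fun h1 _ => ?_, fun h1 => ?_⟩ <;> linarith [h (by linarith)]
end

section
/- Let μ ∈ ℝ, let N be an even positive integer, and suppose the (N+1)×(N+1) matrix L^{(N)}_μ is invertible. Write c¹ for the first column and c^{N+1} for the (N+1)-st column of (L^{(N)}_μ)⁻¹. Define ρ⁽¹⁾ = (1/(N+1))(‖c¹‖_{ℓ¹} + 1), ρ⁽²⁾ = ‖c^{N+1} + (1/(N+2))·c¹‖_{ℓ¹} + 1/(N+2), ρ⁽³⁾ = (2/((N+1)(N+3)))‖c¹‖_{ℓ¹} + 1/(N+1) + 1/(N+3), ρ = (|μ|/2)·max{ρ⁽¹⁾, ρ⁽²⁾, ρ⁽³⁾}, and β = max{ ‖(L^{(N)}_μ)⁻¹‖_{B(ℓ¹)} ,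 (1/(2(N+1)))(‖c¹‖_{ℓ¹} + 1) }. If ρ < 1, then for every y ∈ ℓ¹ there exists a unique a ∈ ℓ¹ with L_μ a = y, and this solution satisfies ‖a‖_{ℓ¹} ≤ (β/(1−ρ))·‖y‖_{ℓ¹}. -/
/-- The matrix norm induced by the `‖·‖₁` vector norm: the maximum over columns of the
sum of absolute values of the entries of the column. -/
noncomputable def mat1norm {m n : ℕ} (A : Matrix (Fin m) (Fin n) ℝ) : ℝ :=
  ⨆ l : Fin n, ∑ i : Fin m, |A i l|

/-- Membership in the sequence space `ℓ¹` (with weights `1, 2, 2, …`, which is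
equivalent to plain absolute summability). -/
def l1Mem (y : ℕ → ℝ) : Prop := Summable fun j => |y j|

/-- The `ℓ¹` norm `‖y‖ = |y_0| + 2 Σ_{j≥1} |y_j|`. -/
noncomputable def l1Norm (y : ℕ → ℝ) : ℝ := |y 0| + 2 * ∑' j : ℕ, |y (j + 1)|

/-- The linear operator `L_μ` on sequences:
`(L_μ a)_0 = a_0 + 2 Σ_{ℓ≥1} (−1)^ℓ a_ℓ` and
`(L_μ a)_j = μ a_{j−1} + 2j a_j − μ a_{j+1}` for `j ≥ 1`. -/
noncomputable def Lop (μ : ℝ) (a : ℕ → ℝ) : ℕ → ℝ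
  | 0 => a 0 + 2 * ∑' ℓ : ℕ, (-1 : ℝ) ^ (ℓ + 1) * a (ℓ + 1)
  | j + 1 => μ * a j + 2 * ((j : ℝ) + 1) * a (j + 1) - μ * a (j + 2)

/-- The first column of `(L^{(N)}_μ)⁻¹`. -/
noncomputable def col1 (N : ℕ) (μ : ℝ) : Fin (N + 1) → ℝ := fun i => (Lmat N μ)⁻¹ i 0

/-- The last (i.e. `(N+1)`-st) column of `(L^{(N)}_μ)⁻¹`. -/
noncomputable def colLast (N : ℕ) (μ : ℝ) : Fin (N + 1) → ℝ :=
  fun i => (Lmat N μ)⁻¹ i (Fin.last N)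

/-- `ρ = (|μ|/2)·max{ρ⁽¹⁾, ρ⁽²⁾, ρ⁽³⁾}` built from the columns of `(L^{(N)}_μ)⁻¹`. -/
noncomputable def rhoB (N : ℕ) (μ : ℝ) : ℝ :=
  (|μ| / 2) *
    max ((1 / ((N : ℝ) + 1)) * (vecl1 (col1 N μ) + 1))
      (max (vecl1 (fun i => colLast N μ i + (1 / ((N : ℝ) + 2)) * col1 N μ i) + 1 / ((N : ℝ) + 2))
        ((2 / (((N : ℝ) + 1) * ((N : ℝ) + 3))) * vecl1 (col1 N μ) + 1 / ((N : ℝ) + 1) +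
          1 / ((N : ℝ) + 3)))

/-- `β = max{ ‖(L^{(N)}_μ)⁻¹‖_{B(ℓ¹)} , (1/(2(N+1)))(‖c¹‖_{ℓ¹} + 1) }`. -/
noncomputable def betaB (N : ℕ) (μ : ℝ) : ℝ :=
  max (matBl1 ((Lmat N μ)⁻¹)) ((1 / (2 * ((N : ℝ) + 1))) * (vecl1 (col1 N μ) + 1))

section VectorNorm

variable {N : ℕ}

lemma vecl1_nonneg (v : Fin (N + 1) → ℝ) : 0 ≤ vecl1 v := by
  unfold vecl1; positivity

lemma vecl1_add_le (v w : Fin (N + 1) → ℝ) : vecl1 (v + w) ≤ vecl1 v + vecl1 w := by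
  have h : ∑ j : Fin N, |(v + w) j.succ| ≤ ∑ j : Fin N, |v j.succ| + ∑ j : Fin N, |w j.succ| := by
    rw [← Finset.sum_add_distrib]
    exact Finset.sum_le_sum fun j _ => abs_add_le _ _
  have h0 := abs_add_le (v 0) (w 0)
  unfold vecl1
  simp only [Pi.add_apply] at h ⊢
  linarith

lemma vecl1_smul (c : ℝ) (v : Fin (N + 1) → ℝ) : vecl1 (c • v) = |c| * vecl1 v := by
  simp only [vecl1, Pi.smul_apply, smul_eq_mul, abs_mul, ← Finset.mul_sum]
  ring

lemma vecl1_sum_le {ι : Type*} (s : Finset ι) (f : ι → Fin (N + 1) → ℝ) :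
    vecl1 (∑ i ∈ s, f i) ≤ ∑ i ∈ s, vecl1 (f i) :=
  Finset.le_sum_of_subadditive vecl1 (by simp [vecl1]) vecl1_add_le s f

lemma vecl1_col_zero_le (A : Matrix (Fin (N + 1)) (Fin (N + 1)) ℝ) :
    vecl1 (A.col 0) ≤ matBl1 A := le_max_left _ _

lemma vecl1_col_succ_le (A : Matrix (Fin (N + 1)) (Fin (N + 1)) ℝ) (n : Fin N) :
    vecl1 (A.col n.succ) ≤ 2 * matBl1 A := by
  have h : (1 / 2) * |A 0 n.succ| + ∑ j : Fin N, |A j.succ n.succ| ≤ matBl1 A :=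
    (le_ciSup (f := fun n : Fin N => (1 / 2) * |A 0 n.succ| + ∑ j : Fin N, |A j.succ n.succ|)
      (Set.finite_range _).bddAbove n).trans (le_max_right _ _)
  simp only [vecl1, Matrix.col_apply]
  linarith

lemma vecl1_mulVec_le (A : Matrix (Fin (N + 1)) (Fin (N + 1)) ℝ) (v : Fin (N + 1) → ℝ) :
    vecl1 (A.mulVec v) ≤ matBl1 A * vecl1 v := by
  have hcols : A.mulVec v = ∑ n, v n • A.col n := by
    ext i
    simp [Matrix.mulVec, dotProduct, Finset.sum_apply, mul_comm]
  rw [hcols]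
  refine (vecl1_sum_le _ _).trans ?_
  simp only [vecl1_smul]
  rw [Fin.sum_univ_succ]
  have h0 := mul_le_mul_of_nonneg_left (vecl1_col_zero_le A) (abs_nonneg (v 0))
  have h1 : ∑ n : Fin N, |v n.succ| * vecl1 (A.col n.succ) ≤
      ∑ n : Fin N, |v n.succ| * (2 * matBl1 A) :=
    Finset.sum_le_sum fun n _ =>
      mul_le_mul_of_nonneg_left (vecl1_col_succ_le A n) (abs_nonneg _)
  rw [← Finset.sum_mul] at h1
  simp only [vecl1] at h0 ⊢
  simp only [vecl1] at h1
  linarith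

end VectorNorm

section SequenceSpace

lemma abs_tsum_le_tsum {f g : ℕ → ℝ} (hg : Summable g) (h : ∀ k, |f k| ≤ g k) :
    |∑' k, f k| ≤ ∑' k, g k :=
  tsum_of_norm_bounded (f := f) hg.hasSum h

lemma l1Mem.sub {a b : ℕ → ℝ} (ha : l1Mem a) (hb : l1Mem b) : l1Mem (a - b) :=
  (Summable.of_nonneg_of_le (fun _ => abs_nonneg _) (fun j => abs_sub (a j) (b j))
    (Summable.add ha hb))

lemma l1Mem.mono {a b : ℕ → ℝ} (hb : l1Mem b) (C : ℝ) (h : ∀ j, |a j| ≤ C * |b j|) : l1Mem a :=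
  Summable.of_nonneg_of_le (fun _ => abs_nonneg _) h (Summable.mul_left C hb)

lemma l1Mem.shift {a : ℕ → ℝ} (ha : l1Mem a) (m : ℕ) : Summable fun k => |a (m + k)| :=
  ha.comp_injective (add_right_injective m)

lemma l1Norm_nonneg (a : ℕ → ℝ) : 0 ≤ l1Norm a := by
  have : 0 ≤ ∑' j : ℕ, |a (j + 1)| := tsum_nonneg fun _ => abs_nonneg _
  unfold l1Norm; positivity

lemma eq_zero_of_l1Norm_nonpos {a : ℕ → ℝ} (ha : l1Mem a) (h : l1Norm a ≤ 0) : a = 0 := by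
  have hs : Summable fun j => |a (j + 1)| := (summable_nat_add_iff 1).2 ha
  have hn : 0 ≤ ∑' j : ℕ, |a (j + 1)| := tsum_nonneg fun _ => abs_nonneg _
  have h0 := abs_nonneg (a 0)
  unfold l1Norm at h
  funext j
  cases j with
  | zero => exact abs_eq_zero.1 (by linarith)
  | succ j =>
    have := hs.le_tsum j fun _ _ => abs_nonneg _
    exact abs_eq_zero.1 (by linarith [abs_nonneg (a (j + 1))])

/-- The truncation of a sequence to its first `N + 1` entries. -/
def headVec (N : ℕ) (a : ℕ → ℝ) : Fin (N + 1) → ℝ := fun i => a i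

lemma l1Norm_eq_head_add_tail {a : ℕ → ℝ} (ha : l1Mem a) (N : ℕ) :
    l1Norm a = vecl1 (headVec N a) + 2 * ∑' k, |a (N + 1 + k)| := by
  have hs : Summable fun j => |a (j + 1)| := (summable_nat_add_iff 1).2 ha
  rw [l1Norm, ← hs.sum_add_tsum_nat_add N, ← Fin.sum_univ_eq_sum_range (fun j => |a (j + 1)|) N]
  have : ∀ k, k + N + 1 = N + 1 + k := fun k => by ring
  simp only [vecl1, headVec, Fin.val_zero, Fin.val_succ, this]
  ring

lemma l1Norm_le_add_sub {a b : ℕ → ℝ} (ha : l1Mem a) (hb : l1Mem b) :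
    l1Norm a ≤ l1Norm b + l1Norm (b - a) := by
  have hs {c : ℕ → ℝ} (hc : l1Mem c) : Summable fun j => |c (j + 1)| :=
    (summable_nat_add_iff 1).2 hc
  have key (j : ℕ) : |a j| ≤ |b j| + |(b - a) j| := by
    have := abs_sub (b j) ((b - a) j)
    simpa using this
  have h := (hs ha).tsum_le_tsum (fun j => key (j + 1)) ((hs hb).add (hs (hb.sub ha)))
  rw [(hs hb).tsum_add (hs (hb.sub ha))] at h
  have h0 := key 0
  unfold l1Norm
  linarith

/-- The weights of `l1Norm`. -/
def l1Weight (j : ℕ) : ℝ := if j = 0 then 1 else 2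

lemma l1Weight_pos (j : ℕ) : 0 < l1Weight j := by unfold l1Weight; split_ifs <;> norm_num

lemma l1Mem_weight_mul {a : ℕ → ℝ} (ha : l1Mem a) : l1Mem fun j => l1Weight j * a j := by
  refine ha.mono 2 fun j => ?_
  rw [abs_mul, abs_of_pos (l1Weight_pos j)]
  refine mul_le_mul_of_nonneg_right ?_ (abs_nonneg _)
  unfold l1Weight; split_ifs <;> norm_num

lemma l1Norm_eq_tsum {a : ℕ → ℝ} (ha : l1Mem a) : l1Norm a = ∑' j, |l1Weight j * a j| := by
  have h : Summable fun j => |l1Weight j * a j| := l1Mem_weight_mul ha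
  rw [h.tsum_eq_zero_add]
  simp [l1Weight, l1Norm, abs_mul, tsum_mul_left]

lemma memℓp_one_iff_l1Mem (a : ℕ → ℝ) : Memℓp a 1 ↔ l1Mem a := by
  rw [memℓp_gen_iff (by norm_num)]
  simp [l1Mem]

lemma l1Mem_div_weight {a : ℕ → ℝ} (ha : l1Mem a) : l1Mem fun j => a j / l1Weight j := by
  refine ha.mono 1 fun j => ?_
  rw [abs_div, abs_of_pos (l1Weight_pos j), one_mul]
  refine div_le_self (abs_nonneg _) ?_
  unfold l1Weight; split_ifs <;> norm_num

/-- The contraction principle for `l1Norm`. -/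
lemma exists_fixedPoint_of_l1Norm_contraction (F : (ℕ → ℝ) → ℕ → ℝ) {r : ℝ} (hr0 : 0 ≤ r)
    (hr1 : r < 1) (hF : ∀ a, l1Mem a → l1Mem (F a))
    (hc : ∀ a b, l1Mem a → l1Mem b → l1Norm (F a - F b) ≤ r * l1Norm (a - b)) :
    ∃ a, l1Mem a ∧ F a = a := by
  let unw (x : lp (fun _ : ℕ => ℝ) 1) : ℕ → ℝ := fun j => x j / l1Weight j
  have hunw (x) : l1Mem (unw x) := l1Mem_div_weight ((memℓp_one_iff_l1Mem _).1 (lp.memℓp x))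
  let G (x : lp (fun _ : ℕ => ℝ) 1) : lp (fun _ : ℕ => ℝ) 1 :=
    ⟨fun j => l1Weight j * F (unw x) j,
      (memℓp_one_iff_l1Mem _).2 (l1Mem_weight_mul (hF _ (hunw x)))⟩
  have hnorm (x : lp (fun _ : ℕ => ℝ) 1) : ‖x‖ = ∑' j, |x j| := by
    rw [lp.norm_eq_tsum_rpow (by norm_num)]
    simp
  have hG : ContractingWith ⟨r, hr0⟩ G := by
    refine ⟨by exact_mod_cast hr1, LipschitzWith.of_dist_le_mul fun x x' => ?_⟩
    have key := hc _ _ (hunw x) (hunw x')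
    rw [l1Norm_eq_tsum ((hF _ (hunw x)).sub (hF _ (hunw x'))),
      l1Norm_eq_tsum ((hunw x).sub (hunw x'))] at key
    rw [dist_eq_norm, dist_eq_norm, hnorm, hnorm]
    have h1 (j : ℕ) : (G x - G x') j = l1Weight j * (F (unw x) - F (unw x')) j := by
      simp only [lp.coeFn_sub, Pi.sub_apply, mul_sub, G]
    have h2 (j : ℕ) : (x - x') j = l1Weight j * (unw x - unw x') j := by
      simp only [lp.coeFn_sub, Pi.sub_apply, unw, ← sub_div]
      rw [mul_div_cancel₀ _ (l1Weight_pos j).ne']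
    simp only [h1, h2]
    exact key
  refine ⟨unw (hG.fixedPoint G), hunw _, ?_⟩
  have hfix : G (hG.fixedPoint G) = hG.fixedPoint G := hG.fixedPoint_isFixedPt
  funext j
  have hj : l1Weight j * F (unw (hG.fixedPoint G)) j = hG.fixedPoint G j :=
    congrArg (fun x : lp (fun _ : ℕ => ℝ) 1 => x j) hfix
  rw [eq_comm]
  change hG.fixedPoint G j / l1Weight j = _
  rw [← hj, mul_div_cancel_left₀ _ (l1Weight_pos j).ne']

end SequenceSpace

section ApproximateInverse

variable {N : ℕ} {μ : ℝ}

/-- The contribution `∑_{n > N} (-1)^n z_n / n` of the tail to the zeroth row, for `N` even. -/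
noncomputable def tailSum (N : ℕ) (z : ℕ → ℝ) : ℝ :=
  ∑' k : ℕ, (-1 : ℝ) ^ (k + 1) * (z (N + 1 + k) / ((N : ℝ) + 1 + k))

/-- The inverse of the operator that agrees with `Lop` in the zeroth row, with `Lmat` on the
first `N + 1` entries, and with the diagonal part of `Lop` on the remaining ones. -/
noncomputable def approxInv (N : ℕ) (μ : ℝ) (z : ℕ → ℝ) (j : ℕ) : ℝ :=
  if h : j < N + 1 then
    ((Lmat N μ)⁻¹.mulVec (headVec N z - tailSum N z • Pi.single 0 1)) ⟨j, h⟩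
  else z j / (2 * j)

/-- The difference between `Lop` and the operator inverted by `approxInv`. -/
def remainderOp (N : ℕ) (μ : ℝ) (a : ℕ → ℝ) (j : ℕ) : ℝ :=
  (if N < j then μ * a (j - 1) else 0) - (if N ≤ j then μ * a (j + 1) else 0)

lemma headVec_approxInv_eq_mulVec (z : ℕ → ℝ) :
    headVec N (approxInv N μ z) =
      (Lmat N μ)⁻¹.mulVec (headVec N z - tailSum N z • Pi.single 0 1) := by
  ext i
  simp only [headVec, approxInv, i.isLt, dif_pos]

lemma headVec_approxInv (z : ℕ → ℝ) :
    headVec N (approxInv N μ z) =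
      (Lmat N μ)⁻¹.mulVec (headVec N z) - tailSum N z • col1 N μ := by
  have : col1 N μ = (Lmat N μ)⁻¹.mulVec (Pi.single 0 1) := by
    ext i; simp [col1]
  rw [this, ← Matrix.mulVec_smul, ← Matrix.mulVec_sub, headVec_approxInv_eq_mulVec]

lemma approxInv_tail (z : ℕ → ℝ) (k : ℕ) :
    approxInv N μ z (N + 1 + k) = z (N + 1 + k) / (2 * ((N : ℝ) + 1 + k)) := by
  rw [approxInv, dif_neg (by omega)]
  push_cast; rfl

lemma abs_tailSum_term_le (z : ℕ → ℝ) (k : ℕ) :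
    |(-1 : ℝ) ^ (k + 1) * (z (N + 1 + k) / ((N : ℝ) + 1 + k))| ≤
      1 / ((N : ℝ) + 1) * |z (N + 1 + k)| := by
  rw [abs_mul, abs_pow, abs_neg, abs_one, one_pow, one_mul, abs_div, div_mul_eq_mul_div, one_mul,
    abs_of_pos (by positivity : (0 : ℝ) < N + 1 + k)]
  refine div_le_div_of_nonneg_left (abs_nonneg _) (by positivity) ?_
  linarith [(Nat.cast_nonneg k : (0 : ℝ) ≤ k)]

lemma summable_tailSum {z : ℕ → ℝ} (hz : l1Mem z) :
    Summable fun k : ℕ => (-1 : ℝ) ^ (k + 1) * (z (N + 1 + k) / ((N : ℝ) + 1 + k)) :=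
  Summable.of_abs <| Summable.of_nonneg_of_le (fun _ => abs_nonneg _) (abs_tailSum_term_le z)
    ((hz.shift (N + 1)).mul_left _)

lemma tailSum_sub {z z' : ℕ → ℝ} (hz : l1Mem z) (hz' : l1Mem z') :
    tailSum N (z - z') = tailSum N z - tailSum N z' := by
  rw [tailSum, tailSum, tailSum, ← (summable_tailSum hz).tsum_sub (summable_tailSum hz')]
  exact tsum_congr fun k => by simp only [Pi.sub_apply]; ring

lemma approxInv_sub {z z' : ℕ → ℝ} (hz : l1Mem z) (hz' : l1Mem z') :
    approxInv N μ (z - z') = approxInv N μ z - approxInv N μ z' := by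
  funext j
  by_cases h : j < N + 1
  · have h1 : headVec N (approxInv N μ (z - z')) =
        headVec N (approxInv N μ z) - headVec N (approxInv N μ z') := by
      rw [headVec_approxInv, headVec_approxInv, headVec_approxInv, tailSum_sub hz hz',
        show headVec N (z - z') = headVec N z - headVec N z' from rfl, Matrix.mulVec_sub, sub_smul]
      abel
    exact congrFun h1 ⟨j, h⟩
  · simp only [Pi.sub_apply, approxInv, h, dif_neg, not_false_eq_true]
    ring

lemma l1Mem_approxInv {z : ℕ → ℝ} (hz : l1Mem z) : l1Mem (approxInv N μ z) := by
  rw [l1Mem, ← summable_nat_add_iff (N + 1)]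
  refine Summable.of_nonneg_of_le (fun _ => abs_nonneg _) (fun k => ?_) (hz.shift (N + 1))
  rw [add_comm k, approxInv_tail, abs_div]
  refine div_le_self (abs_nonneg _) ?_
  rw [abs_of_nonneg (by positivity)]
  linarith [(Nat.cast_nonneg k : (0 : ℝ) ≤ k), (Nat.cast_nonneg N : (0 : ℝ) ≤ N)]

lemma remainderOp_sub (a b : ℕ → ℝ) :
    remainderOp N μ (a - b) = remainderOp N μ a - remainderOp N μ b := by
  funext j
  simp only [remainderOp, Pi.sub_apply]
  split_ifs <;> ring

lemma remainderOp_tail (a : ℕ → ℝ) (k : ℕ) :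
    remainderOp N μ a (N + 1 + k) = μ * (a (N + k) - a (N + k + 2)) := by
  rw [remainderOp, if_pos (by omega), if_pos (by omega), show N + 1 + k - 1 = N + k by omega,
    show N + 1 + k + 1 = N + k + 2 by omega]
  ring

lemma headVec_remainderOp (a : ℕ → ℝ) :
    headVec N (remainderOp N μ a) = (-(μ * a (N + 1))) • Pi.single (Fin.last N) 1 := by
  ext i
  by_cases h : i = Fin.last N
  · subst h
    simp [headVec, remainderOp]
  · have h' : (i : ℕ) < N := Fin.val_lt_last h
    simp [headVec, remainderOp, h, h'.not_ge, h'.le.not_gt]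

lemma l1Mem_remainderOp {a : ℕ → ℝ} (ha : l1Mem a) : l1Mem (remainderOp N μ a) := by
  rw [l1Mem, ← summable_nat_add_iff (N + 1)]
  refine Summable.of_nonneg_of_le (fun _ => abs_nonneg _) (fun k => ?_)
    (((ha.shift N).add (ha.shift (N + 2))).mul_left |μ|)
  rw [add_comm k, remainderOp_tail, abs_mul, add_right_comm N 2 k]
  exact mul_le_mul_of_nonneg_left (abs_sub _ _) (abs_nonneg _)

lemma l1Norm_approxInv_le {z : ℕ → ℝ} (hz : l1Mem z) :
    l1Norm (approxInv N μ z) ≤ betaB N μ * l1Norm z := by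
  rw [l1Norm_eq_head_add_tail (l1Mem_approxInv hz) N, l1Norm_eq_head_add_tail hz N,
    headVec_approxInv]
  set T := ∑' k, |z (N + 1 + k)| with hT
  have hT0 : 0 ≤ T := tsum_nonneg fun _ => abs_nonneg _
  have hhead : vecl1 ((Lmat N μ)⁻¹.mulVec (headVec N z) - tailSum N z • col1 N μ) ≤
      matBl1 (Lmat N μ)⁻¹ * vecl1 (headVec N z) + |tailSum N z| * vecl1 (col1 N μ) := by
    rw [sub_eq_add_neg, ← neg_smul]
    refine (vecl1_add_le _ _).trans (add_le_add (vecl1_mulVec_le _ _) ?_)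
    rw [vecl1_smul, abs_neg]
  have ht : |tailSum N z| ≤ 1 / ((N : ℝ) + 1) * T := by
    rw [hT, ← tsum_mul_left]
    exact abs_tsum_le_tsum ((hz.shift (N + 1)).mul_left _) (abs_tailSum_term_le z)
  have htail : ∑' k, |approxInv N μ z (N + 1 + k)| ≤ 1 / (2 * ((N : ℝ) + 1)) * T := by
    rw [hT, ← tsum_mul_left]
    refine ((l1Mem_approxInv hz).shift (N + 1)).tsum_le_tsum (fun k => ?_)
      ((hz.shift (N + 1)).mul_left _)
    rw [approxInv_tail, abs_div, div_mul_eq_mul_div, one_mul,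
      abs_of_pos (by positivity : (0 : ℝ) < 2 * (N + 1 + k))]
    refine div_le_div_of_nonneg_left (abs_nonneg _) (by positivity) ?_
    linarith [(Nat.cast_nonneg k : (0 : ℝ) ≤ k)]
  have hb1 : matBl1 (Lmat N μ)⁻¹ * vecl1 (headVec N z) ≤ betaB N μ * vecl1 (headVec N z) :=
    mul_le_mul_of_nonneg_right (le_max_left _ _) (vecl1_nonneg _)
  have hb2 : 1 / (2 * ((N : ℝ) + 1)) * (vecl1 (col1 N μ) + 1) * (2 * T) ≤
      betaB N μ * (2 * T) :=
    mul_le_mul_of_nonneg_right (le_max_right _ _) (by positivity)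
  have hb3 : 1 / (2 * ((N : ℝ) + 1)) * (vecl1 (col1 N μ) + 1) * (2 * T) =
      1 / ((N : ℝ) + 1) * T * vecl1 (col1 N μ) + 2 * (1 / (2 * ((N : ℝ) + 1)) * T) := by
    field_simp
  have ht' := mul_le_mul_of_nonneg_right ht (vecl1_nonneg (col1 N μ))
  linarith

/-- Summation by parts for the tail of the remainder. -/
lemma tailSum_remainderOp {a : ℕ → ℝ} (ha : l1Mem a) :
    tailSum N (remainderOp N μ a) = μ * (a (N + 1) / ((N : ℝ) + 2) - a N / ((N : ℝ) + 1) +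
      ∑' k : ℕ, (-1 : ℝ) ^ k * a (N + 2 + k) *
        (1 / ((N : ℝ) + 1 + k) - 1 / ((N : ℝ) + 3 + k))) := by
  have hN : (0 : ℝ) ≤ N := Nat.cast_nonneg N
  let f (k : ℕ) : ℝ := (-1 : ℝ) ^ (k + 1) * (a (N + k) / ((N : ℝ) + 1 + k))
  let g (k : ℕ) : ℝ := (-1 : ℝ) ^ (k + 1) * (a (N + 2 + k) / ((N : ℝ) + 1 + k))
  have hsum (m : ℕ) :
      Summable fun k : ℕ => (-1 : ℝ) ^ (k + 1) * (a (m + k) / ((N : ℝ) + 1 + k)) := by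
    refine Summable.of_abs (Summable.of_nonneg_of_le (fun _ => abs_nonneg _) (fun k => ?_)
      (ha.shift m))
    rw [abs_mul, abs_pow, abs_neg, abs_one, one_pow, one_mul, abs_div]
    refine div_le_self (abs_nonneg _) ?_
    rw [abs_of_nonneg (by positivity)]
    linarith [(Nat.cast_nonneg k : (0 : ℝ) ≤ k)]
  have hf : Summable f := hsum N
  have hg : Summable g := hsum (N + 2)
  have h1 : tailSum N (remainderOp N μ a) = μ * (∑' k, f k - ∑' k, g k) := by
    rw [← hf.tsum_sub hg, ← tsum_mul_left, tailSum]
    refine tsum_congr fun k => ?_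
    rw [remainderOp_tail]
    simp only [f, g, add_right_comm N 2 k]
    ring
  rw [h1, ← hf.sum_add_tsum_nat_add 2, add_sub_assoc,
    ← ((summable_nat_add_iff 2).2 hf).tsum_sub hg]
  congr 1
  congr 1
  · simp only [Finset.sum_range_succ, Finset.sum_range_zero, f]
    push_cast
    ring_nf
  · refine tsum_congr fun k => ?_
    simp only [f, g]
    rw [show N + (k + 2) = N + 2 + k by ring]
    push_cast
    rw [show (N : ℝ) + 1 + (k + 2) = N + 3 + k by ring]
    ring

lemma rhoB_nonneg (N : ℕ) (μ : ℝ) : 0 ≤ rhoB N μ := by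
  have := vecl1_nonneg (col1 N μ)
  refine mul_nonneg (by positivity) (le_max_of_le_left (by positivity))

lemma two_mul_tail_le_l1Norm (hN : 0 < N) {a : ℕ → ℝ} (ha : l1Mem a) :
    2 * (|a N| + |a (N + 1)| + ∑' k, |a (N + 2 + k)|) ≤ l1Norm a := by
  rw [l1Norm_eq_head_add_tail ha N, (ha.shift (N + 1)).tsum_eq_zero_add]
  have h : 2 * |a N| ≤ vecl1 (headVec N a) := by
    obtain ⟨n, rfl⟩ : ∃ n, N = n + 1 := ⟨N - 1, by omega⟩
    have h1 := Finset.single_le_sum (f := fun j : Fin (n + 1) => |headVec (n + 1) a j.succ|)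
      (fun _ _ => abs_nonneg _) (Finset.mem_univ (Fin.last n))
    simp only [headVec, Fin.val_succ, Fin.val_last] at h1
    simp only [vecl1, headVec, Fin.val_succ]
    linarith [abs_nonneg (a ((0 : Fin (n + 1 + 1)) : ℕ))]
  have h2 : ∀ k, N + 1 + (k + 1) = N + 2 + k := fun k => by ring
  simp only [h2, add_zero]
  linarith

lemma abs_tsum_by_parts_le {a : ℕ → ℝ} (ha : l1Mem a) :
    |∑' k : ℕ, (-1 : ℝ) ^ k * a (N + 2 + k) * (1 / ((N : ℝ) + 1 + k) - 1 / ((N : ℝ) + 3 + k))| ≤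
      2 / (((N : ℝ) + 1) * ((N : ℝ) + 3)) * ∑' k, |a (N + 2 + k)| := by
  rw [← tsum_mul_left]
  refine abs_tsum_le_tsum ((ha.shift (N + 2)).mul_left _) fun k => ?_
  have hk : (0 : ℝ) ≤ k := Nat.cast_nonneg k
  have hd : 1 / ((N : ℝ) + 1 + k) - 1 / ((N : ℝ) + 3 + k) =
      2 / (((N : ℝ) + 1 + k) * ((N : ℝ) + 3 + k)) := by
    field_simp
    ring
  rw [hd, abs_mul, abs_mul, abs_pow, abs_neg, abs_one, one_pow, one_mul,
    mul_comm, abs_of_pos (by positivity)]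
  refine mul_le_mul_of_nonneg_right (div_le_div_of_nonneg_left (by norm_num) (by positivity) ?_)
    (abs_nonneg _)
  exact mul_le_mul (by linarith) (by linarith) (by positivity) (by positivity)

lemma headVec_approxInv_remainderOp (a : ℕ → ℝ) (R : ℝ)
    (hR : tailSum N (remainderOp N μ a) =
      μ * (a (N + 1) / ((N : ℝ) + 2) - a N / ((N : ℝ) + 1) + R)) :
    headVec N (approxInv N μ (remainderOp N μ a)) =
      (-(μ * a (N + 1))) • (fun i => colLast N μ i + (1 / ((N : ℝ) + 2)) * col1 N μ i) +
        (μ * a N * (1 / ((N : ℝ) + 1)) + -(μ * R)) • col1 N μ := by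
  have : (Lmat N μ)⁻¹.mulVec (Pi.single (Fin.last N) 1) = colLast N μ := by
    ext i; simp [colLast]
  rw [headVec_approxInv, headVec_remainderOp, Matrix.mulVec_smul, this, hR]
  ext i
  simp only [Pi.sub_apply, Pi.add_apply, Pi.smul_apply, smul_eq_mul]
  ring

lemma two_mul_tsum_tail_approxInv_remainderOp_le {a : ℕ → ℝ} (ha : l1Mem a) :
    2 * ∑' k, |approxInv N μ (remainderOp N μ a) (N + 1 + k)| ≤
      |μ| * (1 / ((N : ℝ) + 1) * |a N| + 1 / ((N : ℝ) + 2) * |a (N + 1)| +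
        (1 / ((N : ℝ) + 1) + 1 / ((N : ℝ) + 3)) * ∑' k, |a (N + 2 + k)|) := by
  have hk (k : ℕ) : (0 : ℝ) ≤ k := Nat.cast_nonneg k
  have hN : (0 : ℝ) ≤ N := Nat.cast_nonneg N
  let f (k : ℕ) : ℝ := 1 / ((N : ℝ) + 1 + k) * |a (N + k)|
  have hf : Summable f := by
    refine Summable.of_nonneg_of_le (fun k => by positivity) (fun k => ?_) (ha.shift N)
    refine mul_le_of_le_one_left (abs_nonneg _) ?_
    rw [div_le_one (by positivity)]
    linarith [hk k]
  have hT := ha.shift (N + 2)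
  have hfT : ∑' k, f k ≤ 1 / ((N : ℝ) + 1) * |a N| + 1 / ((N : ℝ) + 2) * |a (N + 1)| +
      1 / ((N : ℝ) + 3) * ∑' k, |a (N + 2 + k)| := by
    rw [← hf.sum_add_tsum_nat_add 2, ← tsum_mul_left]
    refine add_le_add (le_of_eq ?_) (((summable_nat_add_iff 2).2 hf).tsum_le_tsum (fun k => ?_)
      (hT.mul_left _))
    · simp only [Finset.sum_range_succ, Finset.sum_range_zero, f]
      push_cast
      ring_nf
    · simp only [f]
      rw [show N + (k + 2) = N + 2 + k by ring]
      push_cast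
      gcongr 1 / ?_ * _
      linarith [hk k]
  have hterm (k : ℕ) : 2 * |approxInv N μ (remainderOp N μ a) (N + 1 + k)| ≤
      |μ| * (f k + 1 / ((N : ℝ) + 1) * |a (N + 2 + k)|) := by
    have hpos : (0 : ℝ) < N + 1 + k := by positivity
    have h1 : 1 / ((N : ℝ) + 1 + k) * |a (N + 2 + k)| ≤ 1 / ((N : ℝ) + 1) * |a (N + 2 + k)| := by
      gcongr 1 / ?_ * _
      linarith [hk k]
    rw [approxInv_tail, remainderOp_tail, abs_div, abs_mul, abs_of_pos (by positivity : (0 : ℝ) <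
      2 * (N + 1 + k)), add_right_comm N k 2]
    calc 2 * (|μ| * |a (N + k) - a (N + 2 + k)| / (2 * ((N : ℝ) + 1 + k)))
        = |μ| * (1 / ((N : ℝ) + 1 + k) * |a (N + k) - a (N + 2 + k)|) := by field_simp
      _ ≤ |μ| * (1 / ((N : ℝ) + 1 + k) * (|a (N + k)| + |a (N + 2 + k)|)) := by
          gcongr
          exact abs_sub _ _
      _ ≤ _ := by
          rw [mul_add (1 / ((N : ℝ) + 1 + k))]
          gcongr
  rw [← tsum_mul_left]
  refine (Summable.tsum_le_tsum hterm
    (((l1Mem_approxInv (l1Mem_remainderOp ha)).shift (N + 1)).mul_left 2)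
    ((hf.add (hT.mul_left _)).mul_left _)).trans ?_
  rw [tsum_mul_left, hf.tsum_add (hT.mul_left _), tsum_mul_left]
  refine mul_le_mul_of_nonneg_left ?_ (abs_nonneg _)
  linarith

lemma l1Norm_approxInv_remainderOp_le (hN : 0 < N) {a : ℕ → ℝ} (ha : l1Mem a) :
    l1Norm (approxInv N μ (remainderOp N μ a)) ≤ rhoB N μ * l1Norm a := by
  have hR := abs_tsum_by_parts_le (N := N) ha
  have hhead := headVec_approxInv_remainderOp a _ (tailSum_remainderOp (N := N) (μ := μ) ha)
  have htail := two_mul_tsum_tail_approxInv_remainderOp_le (N := N) (μ := μ) ha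
  refine le_trans ?_ (mul_le_mul_of_nonneg_left (two_mul_tail_le_l1Norm hN ha) (rhoB_nonneg N μ))
  rw [l1Norm_eq_head_add_tail (l1Mem_approxInv (l1Mem_remainderOp ha)) N, hhead]
  generalize (∑' k : ℕ, (-1 : ℝ) ^ k * a (N + 2 + k) *
    (1 / ((N : ℝ) + 1 + k) - 1 / ((N : ℝ) + 3 + k))) = R at hR ⊢
  have hT0 : 0 ≤ ∑' k, |a (N + 2 + k)| := tsum_nonneg fun _ => abs_nonneg _
  unfold rhoB
  generalize ∑' k, |a (N + 2 + k)| = T at *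
  generalize (fun i => colLast N μ i + (1 / ((N : ℝ) + 2)) * col1 N μ i) = p
  have hc := vecl1_nonneg (col1 N μ)
  have hvec : vecl1 ((-(μ * a (N + 1))) • p +
      (μ * a N * (1 / ((N : ℝ) + 1)) + -(μ * R)) • col1 N μ) ≤
      |μ| * (|a (N + 1)| * vecl1 p + 1 / ((N : ℝ) + 1) * |a N| * vecl1 (col1 N μ) +
        2 / (((N : ℝ) + 1) * ((N : ℝ) + 3)) * T * vecl1 (col1 N μ)) := by
    refine (vecl1_add_le _ _).trans ?_
    rw [vecl1_smul, vecl1_smul, abs_neg, abs_mul]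
    have h1 : |μ * a N * (1 / ((N : ℝ) + 1)) + -(μ * R)| ≤
        |μ| * (1 / ((N : ℝ) + 1) * |a N| + 2 / (((N : ℝ) + 1) * ((N : ℝ) + 3)) * T) := by
      refine (abs_add_le _ _).trans ?_
      rw [abs_neg, abs_mul, abs_mul, abs_mul, abs_of_pos (by positivity : 0 < 1 / ((N : ℝ) + 1))]
      linarith [mul_le_mul_of_nonneg_left hR (abs_nonneg μ)]
    linarith [mul_le_mul_of_nonneg_right h1 hc]
  set m := max ((1 / ((N : ℝ) + 1)) * (vecl1 (col1 N μ) + 1))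
      (max (vecl1 p + 1 / ((N : ℝ) + 2))
        ((2 / (((N : ℝ) + 1) * ((N : ℝ) + 3))) * vecl1 (col1 N μ) + 1 / ((N : ℝ) + 1) +
          1 / ((N : ℝ) + 3))) with hm
  have hm1 : (1 / ((N : ℝ) + 1)) * (vecl1 (col1 N μ) + 1) ≤ m := le_max_left _ _
  have hm2 : vecl1 p + 1 / ((N : ℝ) + 2) ≤ m := (le_max_left _ _).trans (le_max_right _ _)
  have hm3 : (2 / (((N : ℝ) + 1) * ((N : ℝ) + 3))) * vecl1 (col1 N μ) + 1 / ((N : ℝ) + 1) +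
      1 / ((N : ℝ) + 3) ≤ m := (le_max_right _ _).trans (le_max_right _ _)
  have hsum := add_le_add (add_le_add (mul_le_mul_of_nonneg_right hm1 (abs_nonneg (a N)))
    (mul_le_mul_of_nonneg_right hm2 (abs_nonneg (a (N + 1)))))
    (mul_le_mul_of_nonneg_right hm3 hT0)
  linarith [mul_le_mul_of_nonneg_left hsum (abs_nonneg μ)]

end ApproximateInverse

section Factorization

variable {N : ℕ} {μ : ℝ}

lemma Lmat_mulVec_headVec_zero (a : ℕ → ℝ) :
    (Lmat N μ).mulVec (headVec N a) 0 =
      a 0 + 2 * ∑ j ∈ Finset.range N, (-1 : ℝ) ^ (j + 1) * a (j + 1) := by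
  rw [← Fin.sum_univ_eq_sum_range (fun j => (-1 : ℝ) ^ (j + 1) * a (j + 1)) N, Finset.mul_sum]
  simp [Matrix.mulVec, dotProduct, Fin.sum_univ_succ, Lmat, headVec, mul_assoc]

lemma Lmat_mulVec_headVec_succ (a : ℕ → ℝ) (i : Fin N) :
    (Lmat N μ).mulVec (headVec N a) i.succ =
      μ * a i + 2 * ((i : ℝ) + 1) * a (i + 1) - if (i : ℕ) + 1 < N then μ * a (i + 2) else 0 := by
  have hentry (j : Fin (N + 1)) : Lmat N μ i.succ j * headVec N a j =
      (if (j : ℕ) = i then μ * a j else 0) +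
        (if (j : ℕ) = i + 1 then 2 * ((i : ℝ) + 1) * a j else 0) -
        (if (j : ℕ) = i + 2 then μ * a j else 0) := by
    simp only [Lmat, Matrix.of_apply, headVec, Fin.val_succ]
    split_ifs <;> first | contradiction | omega | (push_cast; ring1)
  have hsum (f : ℕ → ℝ) (m : ℕ) : ∑ j : Fin (N + 1), (if (j : ℕ) = m then f j else 0) =
      if m < N + 1 then f m else 0 := by
    rw [Fin.sum_univ_eq_sum_range (fun j => if j = m then f j else 0) (N + 1)]
    simp
  have hi := i.isLt
  simp only [Matrix.mulVec, dotProduct, hentry, Finset.sum_sub_distrib, Finset.sum_add_distrib]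
  rw [hsum (fun j => μ * a j), hsum (fun j => 2 * ((i : ℝ) + 1) * a j), hsum (fun j => μ * a j),
    if_pos (by omega), if_pos (by omega)]
  simp only [show (i : ℕ) + 2 < N + 1 ↔ (i : ℕ) + 1 < N by omega]

lemma Lop_tail (a : ℕ → ℝ) (k : ℕ) :
    Lop μ a (N + 1 + k) =
      2 * ((N : ℝ) + 1 + k) * a (N + 1 + k) + remainderOp N μ a (N + 1 + k) := by
  rw [remainderOp_tail, show N + 1 + k = N + k + 1 by ring, Lop]
  push_cast
  ring

lemma headVec_Lop (hN : 0 < N) (hNe : Even N) {a : ℕ → ℝ} (ha : l1Mem a) :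
    headVec N (Lop μ a) = (Lmat N μ).mulVec (headVec N a) +
      (2 * ∑' k : ℕ, (-1 : ℝ) ^ (k + 1) * a (N + 1 + k)) • Pi.single 0 1 +
      headVec N (remainderOp N μ a) := by
  ext i
  refine Fin.cases ?_ (fun i => ?_) i
  · have hs : Summable fun j : ℕ => (-1 : ℝ) ^ (j + 1) * a (j + 1) := by
      refine Summable.of_abs ?_
      simpa [abs_mul] using (summable_nat_add_iff 1).2 ha
    have hsplit := hs.sum_add_tsum_nat_add N
    have hterm (k : ℕ) : (-1 : ℝ) ^ (k + N + 1) * a (k + N + 1) =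
        (-1 : ℝ) ^ (k + 1) * a (N + 1 + k) := by
      rw [show k + N + 1 = N + (k + 1) by ring, pow_add, hNe.neg_one_pow, one_mul,
        show N + (k + 1) = N + 1 + k by ring]
    simp only [hterm] at hsplit
    simp only [Pi.add_apply, Lmat_mulVec_headVec_zero]
    simp [headVec, Lop, remainderOp, hN.ne', ← hsplit]
    ring
  · have hi := i.isLt
    simp only [Pi.add_apply, Lmat_mulVec_headVec_succ]
    simp only [headVec, Fin.val_succ, Lop, remainderOp, Pi.smul_apply, ne_eq, Fin.succ_ne_zero,
      not_false_eq_true, Pi.single_eq_of_ne, smul_zero]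
    rw [if_neg (by omega : ¬ N < (i : ℕ) + 1)]
    split_ifs <;> first | omega | ring

/-- Preconditioned form of the equation `Lop μ a = y`. -/
lemma Lop_eq_iff (hN : 0 < N) (hNe : Even N) (hL : IsUnit (Lmat N μ)) {a : ℕ → ℝ}
    (ha : l1Mem a) (y : ℕ → ℝ) :
    Lop μ a = y ↔ approxInv N μ (y - remainderOp N μ a) = a := by
  set z := y - remainderOp N μ a with hz
  have hpos (k : ℕ) : (2 * ((N : ℝ) + 1 + k)) ≠ 0 := by positivity
  have hsplit (b c : ℕ → ℝ) :
      b = c ↔ headVec N b = headVec N c ∧ ∀ k, b (N + 1 + k) = c (N + 1 + k) := by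
    refine ⟨fun h => by simp [h], fun ⟨h, h'⟩ => funext fun j => ?_⟩
    by_cases hj : j < N + 1
    · exact congrFun h ⟨j, hj⟩
    · have := h' (j - (N + 1))
      rwa [Nat.add_sub_cancel' (not_lt.1 hj)] at this
  have htail (k : ℕ) : Lop μ a (N + 1 + k) = y (N + 1 + k) ↔
      approxInv N μ z (N + 1 + k) = a (N + 1 + k) := by
    rw [Lop_tail, approxInv_tail, div_eq_iff (hpos k), hz, Pi.sub_apply]
    constructor <;> intro h <;> linarith
  rw [hsplit, hsplit, forall_congr' htail]
  refine and_congr_left fun h => ?_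
  have hts : tailSum N z = 2 * ∑' k : ℕ, (-1 : ℝ) ^ (k + 1) * a (N + 1 + k) := by
    rw [← tsum_mul_left, tailSum]
    refine tsum_congr fun k => ?_
    rw [← h k, approxInv_tail]
    have := hpos k
    field_simp
  have hdet := (Matrix.isUnit_iff_isUnit_det _).1 hL
  rw [headVec_approxInv_eq_mulVec, headVec_Lop hN hNe ha, ← hts,
    show headVec N z = headVec N y - headVec N (remainderOp N μ a) from rfl]
  constructor
  · intro h'
    rw [← h', add_sub_cancel_right, add_sub_cancel_right, Matrix.mulVec_mulVec,
      Matrix.nonsing_inv_mul _ hdet, Matrix.one_mulVec]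
  · intro h'
    rw [← h', Matrix.mulVec_mulVec, Matrix.mul_nonsing_inv _ hdet, Matrix.one_mulVec]
    abel

end Factorization

/-- If `ρ < 1` then `L_μ` is boundedly invertible on `ℓ¹` with
`‖L_μ⁻¹‖ ≤ β/(1−ρ)`. -/
theorem stmt16 (μ : ℝ) (N : ℕ) (hN : 0 < N) (hNe : Even N)
    (hL : IsUnit (Lmat N μ)) (hρ : rhoB N μ < 1) :
    ∀ y : ℕ → ℝ, l1Mem y →
      ∃ a : ℕ → ℝ,
        (l1Mem a ∧ Lop μ a = y ∧ l1Norm a ≤ (betaB N μ / (1 - rhoB N μ)) * l1Norm y) ∧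
        ∀ a' : ℕ → ℝ, l1Mem a' → Lop μ a' = y → a' = a := by
  have hr0 := rhoB_nonneg N μ
  intro y hy
  have hmem (a : ℕ → ℝ) (ha : l1Mem a) : l1Mem (y - remainderOp N μ a) :=
    hy.sub (l1Mem_remainderOp ha)
  have hdiff (a b : ℕ → ℝ) (ha : l1Mem a) (hb : l1Mem b) :
      l1Norm (approxInv N μ (y - remainderOp N μ a) - approxInv N μ (y - remainderOp N μ b)) ≤
        rhoB N μ * l1Norm (b - a) := by
    rw [← approxInv_sub (hmem a ha) (hmem b hb), sub_sub_sub_cancel_left, ← remainderOp_sub]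
    exact l1Norm_approxInv_remainderOp_le hN (hb.sub ha)
  have hcomm (a b : ℕ → ℝ) : l1Norm (b - a) = l1Norm (a - b) := by
    simp only [l1Norm, Pi.sub_apply, abs_sub_comm]
  obtain ⟨a, ha, hfix⟩ := exists_fixedPoint_of_l1Norm_contraction
    (fun a => approxInv N μ (y - remainderOp N μ a)) hr0 hρ
    (fun a ha => l1Mem_approxInv (hmem a ha))
    (fun a b ha hb => (hdiff a b ha hb).trans_eq (by rw [hcomm]))
  have hpos : 0 < 1 - rhoB N μ := by linarith
  refine ⟨a, ⟨ha, (Lop_eq_iff hN hNe hL ha y).2 hfix, ?_⟩, fun b hb hby => ?_⟩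
  · rw [div_mul_eq_mul_div, le_div_iff₀ hpos]
    have h1 := l1Norm_le_add_sub ha (l1Mem_approxInv (N := N) (μ := μ) hy)
    have h2 : approxInv N μ y - a = approxInv N μ (remainderOp N μ a) := by
      conv_lhs => rw [← hfix]
      rw [← approxInv_sub hy (hmem a ha), sub_sub_cancel]
    rw [h2] at h1
    have h3 := l1Norm_approxInv_remainderOp_le (μ := μ) hN ha
    have h4 := l1Norm_approxInv_le (N := N) (μ := μ) hy
    linarith
  · have h := hdiff b a hb ha
    rw [(Lop_eq_iff hN hNe hL hb y).1 hby, show approxInv N μ (y - remainderOp N μ a) = a from hfix,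
      hcomm b a] at h
    refine sub_eq_zero.1 (eq_zero_of_l1Norm_nonpos (hb.sub ha) ?_)
    by_contra! hlt
    linarith [mul_lt_mul_of_pos_right hρ hlt]
end

section
/- For every μ ∈ [0, 1000] and every y ∈ ℓ¹, there exists a unique a ∈ ℓ¹ such that L_μ a = y, and this solution satisfies ‖a‖_{ℓ¹} ≤ 1.45·‖y‖_{ℓ¹}. In other words, the operator L_μ is boundedly invertible on ℓ¹ with ‖L_μ⁻¹‖ ≤ 1.45 uniformly for μ ∈ [0, 1000]. -/
/-! ### The minimal solution of the recurrence -/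

/-- Terms of the series `∑ₙ (μ/2)ⁿ/n! * C(2n, n+k)`, whose sum is `e^μ I_k(μ)` for the modified
Bessel function `I_k`. -/
noncomputable def besselTerm (μ : ℝ) (k n : ℕ) : ℝ :=
  (μ / 2) ^ n / n.factorial * ((2 * n).choose (n + k) : ℝ)

/-- The scaled modified Bessel function `e^μ I_k(μ)`. -/
noncomputable def scaledBessel (μ : ℝ) (k : ℕ) : ℝ := ∑' n, besselTerm μ k n

lemma besselTerm_nonneg {μ : ℝ} (hμ : 0 ≤ μ) (k n : ℕ) : 0 ≤ besselTerm μ k n := by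
  unfold besselTerm; positivity

lemma summable_besselTerm {μ : ℝ} (hμ : 0 ≤ μ) (k : ℕ) : Summable (besselTerm μ k) := by
  refine Summable.of_nonneg_of_le (besselTerm_nonneg hμ k) (fun n => ?_)
    (Real.summable_pow_div_factorial (2 * μ))
  have h1 : ((2 * n).choose (n + k) : ℝ) ≤ 4 ^ n := by
    have := Nat.choose_le_two_pow (2 * n) (n + k)
    rw [pow_mul] at this
    exact_mod_cast this
  have h2 : (2 * μ) ^ n / (n.factorial : ℝ) = (μ / 2) ^ n / n.factorial * 4 ^ n := by
    rw [show 2 * μ = μ / 2 * 4 by ring, mul_pow]; ring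
  rw [h2]
  unfold besselTerm
  gcongr

lemma scaledBessel_pos {μ : ℝ} (hμ : 0 < μ) (k : ℕ) : 0 < scaledBessel μ k := by
  refine (summable_besselTerm hμ.le k).tsum_pos (besselTerm_nonneg hμ.le k) k ?_
  have : 0 < (2 * k).choose (k + k) := Nat.choose_pos (by omega)
  unfold besselTerm
  positivity

lemma cast_choose_succ_mul (N i : ℕ) :
    (N.choose (i + 1) : ℝ) * (i + 1) = N.choose i * (N - i) := by
  rcases le_or_gt i N with h | h
  · have := Nat.choose_succ_right_eq N i
    rw [← Nat.cast_sub h]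
    exact_mod_cast this
  · simp [Nat.choose_eq_zero_of_lt h, Nat.choose_eq_zero_of_lt (Nat.lt_succ_of_lt h)]

lemma scaledBessel_succ_le {μ : ℝ} (hμ : 0 ≤ μ) (k : ℕ) :
    scaledBessel μ (k + 1) ≤ scaledBessel μ k := by
  refine (summable_besselTerm hμ _).tsum_le_tsum (fun n => ?_) (summable_besselTerm hμ _)
  have h := cast_choose_succ_mul (2 * n) (n + k)
  have h1 : ((2 * n).choose (n + (k + 1)) : ℝ) ≤ (2 * n).choose (n + k) := by
    push_cast at h
    have h0 : (0 : ℝ) ≤ (2 * n).choose (n + k) := by positivity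
    have hpos : (0 : ℝ) < n + k + 1 := by positivity
    have hk : (0 : ℝ) ≤ k := by positivity
    rw [← add_assoc]
    refine le_of_mul_le_mul_right ?_ hpos
    rw [h]
    exact mul_le_mul_of_nonneg_left (by linarith) h0
  unfold besselTerm
  gcongr

lemma choose_three_term (n k : ℕ) :
    ((n : ℝ) + 1) * ((2 * n).choose (n + k) - (2 * n).choose (n + k + 2)) =
      (k + 1) * (2 * (n + 1)).choose (n + 1 + (k + 1)) := by
  have h1 := cast_choose_succ_mul (2 * n) (n + k)
  have h2 := cast_choose_succ_mul (2 * n) (n + k + 1)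
  have h3 : (2 * (n + 1)).choose (n + 1 + (k + 1)) = (2 * n).choose (n + k)
      + 2 * (2 * n).choose (n + k + 1) + (2 * n).choose (n + k + 2) := by
    rw [show 2 * (n + 1) = 2 * n + 1 + 1 by ring, show n + 1 + (k + 1) = n + k + 1 + 1 by ring,
      Nat.choose_succ_succ', Nat.choose_succ_succ', Nat.choose_succ_succ']
    ring
  rw [h3]
  push_cast at h1 h2 ⊢
  linear_combination (-1) * h1 - h2

lemma scaledBessel_rec {μ : ℝ} (hμ : 0 ≤ μ) (k : ℕ) :
    μ * (scaledBessel μ k - scaledBessel μ (k + 2)) = 2 * (k + 1) * scaledBessel μ (k + 1) := by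
  have e : scaledBessel μ (k + 1) = ∑' n, besselTerm μ (k + 1) (n + 1) := by
    unfold scaledBessel
    rw [(summable_besselTerm hμ _).tsum_eq_zero_add]
    simp [besselTerm]
  rw [e, ← tsum_mul_left]
  unfold scaledBessel
  rw [← (summable_besselTerm hμ _).tsum_sub (summable_besselTerm hμ _), ← tsum_mul_left]
  refine tsum_congr fun n => ?_
  have h := choose_three_term n k
  unfold besselTerm
  rw [Nat.factorial_succ, pow_succ, ← add_assoc n k 2]
  have hf : (n.factorial : ℝ) ≠ 0 := by positivity
  have hn : (n : ℝ) + 1 ≠ 0 := by positivity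
  push_cast
  field_simp
  linear_combination μ * (μ / 2) ^ n * h

/-! ### The growing solution of the recurrence -/

/-- The solution of `μ q_k + 2(k+1) q_{k+1} - μ q_{k+2} = 0` with `q_0 = 0`, `q_1 = 1`. -/
noncomputable def growingSol (μ : ℝ) : ℕ → ℝ
  | 0 => 0
  | 1 => 1
  | k + 2 => growingSol μ k + 2 * ((k : ℝ) + 1) / μ * growingSol μ (k + 1)

lemma growingSol_nonneg {μ : ℝ} (hμ : 0 < μ) : ∀ k, 0 ≤ growingSol μ k
  | 0 => by simp [growingSol]
  | 1 => by simp [growingSol]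
  | k + 2 => by
    have h1 := growingSol_nonneg hμ k
    have h2 := growingSol_nonneg hμ (k + 1)
    rw [growingSol]
    positivity

lemma growingSol_rec {μ : ℝ} (hμ : 0 < μ) (k : ℕ) :
    μ * growingSol μ (k + 2) = μ * growingSol μ k + 2 * ((k : ℝ) + 1) * growingSol μ (k + 1) := by
  rw [growingSol]
  field_simp

/-- The Casoratian of the two solutions is constant. -/
lemma casoratian_eq {μ : ℝ} (hμ : 0 < μ) (k : ℕ) :
    scaledBessel μ k * growingSol μ (k + 1) + scaledBessel μ (k + 1) * growingSol μ k
      = scaledBessel μ 0 := by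
  induction k with
  | zero => simp [growingSol]
  | succ k ih =>
    have h1 := growingSol_rec hμ k
    have h2 := scaledBessel_rec hμ.le k
    refine mul_left_cancel₀ hμ.ne' ?_
    rw [← ih]
    linear_combination scaledBessel μ (k + 1) * h1 - growingSol μ (k + 1) * h2

lemma two_mul_sum_growingSol_le {μ : ℝ} (hμ : 0 < μ) (m : ℕ) :
    2 * ∑ k ∈ Finset.range (m + 1), growingSol μ (k + 1) ≤
      μ / 2 * (growingSol μ (m + 2) + growingSol μ (m + 1)) - μ / 2 + 1 := by
  induction m with
  | zero =>
    have h := growingSol_rec hμ 0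
    simp [growingSol] at h ⊢
    linarith
  | succ m ih =>
    rw [Finset.sum_range_succ]
    have h := growingSol_rec hμ (m + 1)
    push_cast at h
    have h0 := growingSol_nonneg hμ (m + 2)
    have hm : 0 ≤ (m : ℝ) * growingSol μ (m + 2) := by positivity
    have e1 : m + 1 + 1 = m + 2 := rfl
    have e2 : m + 1 + 2 = m + 3 := rfl
    rw [e1, e2] at h ⊢
    linarith

/-! ### Tail bounds -/

lemma two_mul_sum_scaledBessel_le {μ : ℝ} (hμ : 0 < μ) (k N : ℕ) :
    2 * ∑ i ∈ Finset.range N, scaledBessel μ (k + 1 + i) ≤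
      μ * (scaledBessel μ k / (k + 1) + scaledBessel μ (k + 1) / (k + 2)) := by
  induction N generalizing k with
  | zero =>
    have := scaledBessel_pos hμ k
    have := scaledBessel_pos hμ (k + 1)
    simp only [Finset.range_zero, Finset.sum_empty, mul_zero]
    positivity
  | succ N ih =>
    rw [Finset.sum_range_succ']
    have h := ih (k + 1)
    have hr := scaledBessel_rec hμ.le k
    have hp := scaledBessel_pos hμ (k + 2)
    rw [Finset.sum_congr rfl fun i _ => congrArg (scaledBessel μ)
      (show k + 1 + (i + 1) = k + 1 + 1 + i by ring)]
    push_cast at h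
    have h3 : scaledBessel μ (k + 2) / ((k : ℝ) + 3) ≤ scaledBessel μ (k + 2) / (k + 1) := by
      gcongr
      norm_num
    have h4 : 2 * scaledBessel μ (k + 1)
        = μ * (scaledBessel μ k / (k + 1) - scaledBessel μ (k + 2) / (k + 1)) := by
      have : (k : ℝ) + 1 ≠ 0 := by positivity
      field_simp
      linarith
    rw [show (k : ℝ) + 1 + 1 = k + 2 by ring, show (k : ℝ) + 1 + 2 = k + 3 by ring] at h
    have h5 := mul_le_mul_of_nonneg_left h3 hμ.le
    simp only [add_zero]
    have e2 : k + 1 + 1 = k + 2 := rfl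
    rw [e2] at h ⊢
    linarith

lemma two_mul_sum_scaledBessel_one_le {μ : ℝ} (hμ : 0 < μ) (N : ℕ) :
    2 * ∑ i ∈ Finset.range N, scaledBessel μ (1 + i) ≤ 1.45 * (μ * scaledBessel μ 0) := by
  have p0 := scaledBessel_pos hμ 0
  have p1 := scaledBessel_pos hμ 1
  have p2 := scaledBessel_pos hμ 2
  have p4 := scaledBessel_pos hμ 4
  have r0 := scaledBessel_rec hμ.le 0
  have r1 := scaledBessel_rec hμ.le 1
  have r2 := scaledBessel_rec hμ.le 2
  have d0 := scaledBessel_succ_le hμ.le 0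
  norm_num at r0 r1 r2 d0
  have key : 2 * ∑ i ∈ Finset.range N, scaledBessel μ (1 + i) ≤
      μ * (scaledBessel μ 0 + scaledBessel μ 1 / 2 - 2 / 3 * scaledBessel μ 2) := by
    cases N with
    | zero =>
      have : scaledBessel μ 2 ≤ scaledBessel μ 0 := (scaledBessel_succ_le hμ.le 1).trans d0
      simp only [Finset.range_zero, Finset.sum_empty, mul_zero]
      exact mul_nonneg hμ.le (by linarith)
    | succ N =>
      rw [Finset.sum_range_succ']
      have h := two_mul_sum_scaledBessel_le hμ 1 N
      rw [Finset.sum_congr rfl fun i _ => congrArg (scaledBessel μ)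
        (show 1 + (i + 1) = 1 + 1 + i by ring)]
      norm_num at h ⊢
      linarith
  refine key.trans ?_
  generalize scaledBessel μ 0 = A at *
  generalize scaledBessel μ 1 = B at *
  generalize scaledBessel μ 2 = C at *
  generalize scaledBessel μ 3 = D at *
  generalize scaledBessel μ 4 = E at *
  rcases le_or_gt μ 2.2 with h | h
  · have h5 : B * (8 * μ ^ 2 + 48) ≤ (μ ^ 3 + 24 * μ) * A := by
      have : (μ ^ 3 + 24 * μ) * A - B * (8 * μ ^ 2 + 48) = μ ^ 3 * E := by
        linear_combination (μ ^ 2 + 24) * r0 - 6 * μ * r1 + μ ^ 2 * r2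
      have : 0 < μ ^ 3 * E := by positivity
      linarith
    have h6 : μ ^ 3 + 24 * μ ≤ 0.9 * (8 * μ ^ 2 + 48) := by nlinarith [sq_nonneg μ, sq_nonneg (μ - 2)]
    have h7 : B ≤ 0.9 * A := by
      have h8 : (μ ^ 3 + 24 * μ) * A ≤ 0.9 * (8 * μ ^ 2 + 48) * A :=
        mul_le_mul_of_nonneg_right h6 p0.le
      have : (0 : ℝ) < 8 * μ ^ 2 + 48 := by positivity
      refine le_of_mul_le_mul_right ?_ this
      linarith
    nlinarith
  · nlinarith

/-! ### Solutions with right-hand side a unit sequence -/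

/-- The solution with right-hand side the unit sequence at `m + 1` (in the rows `≥ 1`), obtained by
gluing the growing and the minimal solutions. -/
noncomputable def greenCol (μ : ℝ) (m k : ℕ) : ℝ :=
  (if k ≤ m + 1 then growingSol μ k * scaledBessel μ (m + 1)
    else (-1) ^ (k + (m + 1)) * scaledBessel μ k * growingSol μ (m + 1)) / (μ * scaledBessel μ 0)

lemma greenCol_of_le {μ : ℝ} {m k : ℕ} (h : k ≤ m + 1) :
    greenCol μ m k = growingSol μ k * scaledBessel μ (m + 1) / (μ * scaledBessel μ 0) := by
  rw [greenCol, if_pos h]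

lemma greenCol_of_ge {μ : ℝ} {m k : ℕ} (h : m + 1 ≤ k) :
    greenCol μ m k = (-1) ^ (k + (m + 1)) * scaledBessel μ k * growingSol μ (m + 1)
      / (μ * scaledBessel μ 0) := by
  rcases h.eq_or_lt with rfl | h
  · rw [greenCol_of_le le_rfl, Even.neg_one_pow ⟨m + 1, rfl⟩]; ring
  · rw [greenCol, if_neg (by omega)]

lemma greenCol_rec {μ : ℝ} (hμ : 0 < μ) (m k : ℕ) :
    μ * greenCol μ m k + 2 * ((k : ℝ) + 1) * greenCol μ m (k + 1) - μ * greenCol μ m (k + 2)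
      = if k = m then 1 else 0 := by
  have p0 := scaledBessel_pos hμ 0
  have hq := growingSol_rec hμ k
  have hr := scaledBessel_rec hμ.le k
  rcases lt_trichotomy k m with h | rfl | h
  · rw [greenCol_of_le (by omega), greenCol_of_le (by omega), greenCol_of_le (by omega),
      if_neg h.ne]
    field_simp
    linear_combination (-scaledBessel μ (m + 1)) * hq
  · have hc := casoratian_eq hμ k
    rw [greenCol_of_le (by omega), greenCol_of_le (by omega), greenCol_of_ge (by omega), if_pos rfl,
      Odd.neg_one_pow ⟨k + 1, by ring⟩]
    field_simp
    linear_combination μ * hc - growingSol μ (k + 1) * hr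
  · rw [greenCol_of_ge (by omega), greenCol_of_ge (by omega), greenCol_of_ge (by omega),
      if_neg h.ne']
    field_simp
    rw [show k + 2 + (m + 1) = k + (m + 1) + 2 by ring,
      show k + 1 + (m + 1) = k + (m + 1) + 1 by ring, pow_succ _ (k + (m + 1)), pow_add _ _ 2]
    linear_combination (-1) ^ (k + (m + 1)) * growingSol μ (m + 1) * hr

lemma sum_abs_greenCol_le {μ : ℝ} (hμ : 0 < μ) (m N : ℕ) :
    2 * ∑ k ∈ Finset.range N, |greenCol μ m (k + 1)| ≤ 1.45 := by
  have p0 := scaledBessel_pos hμ 0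
  have hW : 0 < μ * scaledBessel μ 0 := by positivity
  have hle : ∑ k ∈ Finset.range N, |greenCol μ m (k + 1)| ≤
      ∑ k ∈ Finset.range (m + N), |greenCol μ m (k + 1)| :=
    Finset.sum_le_sum_of_subset_of_nonneg (Finset.range_mono (by omega))
      fun _ _ _ => abs_nonneg _
  have h1 : ∑ k ∈ Finset.range m, |greenCol μ m (k + 1)| =
      (∑ k ∈ Finset.range m, growingSol μ (k + 1)) * scaledBessel μ (m + 1)
        / (μ * scaledBessel μ 0) := by
    rw [Finset.sum_mul, Finset.sum_div]
    refine Finset.sum_congr rfl fun k hk => ?_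
    rw [greenCol_of_le (by simp at hk; omega), abs_of_nonneg]
    have := growingSol_nonneg hμ (k + 1)
    have := scaledBessel_pos hμ (m + 1)
    positivity
  have h2 : ∑ i ∈ Finset.range N, |greenCol μ m (m + i + 1)| =
      (∑ i ∈ Finset.range N, scaledBessel μ (m + 1 + i)) * growingSol μ (m + 1)
        / (μ * scaledBessel μ 0) := by
    rw [Finset.sum_mul, Finset.sum_div]
    refine Finset.sum_congr rfl fun i _ => ?_
    have := growingSol_nonneg hμ (m + 1)
    have := scaledBessel_pos hμ (m + 1 + i)
    rw [greenCol_of_ge (by omega), show m + i + 1 = m + 1 + i by ring, abs_div, abs_mul, abs_mul,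
      abs_pow, abs_neg, abs_one, one_pow, one_mul, abs_of_pos hW, abs_of_nonneg this.le,
      abs_of_nonneg ‹0 ≤ growingSol μ (m + 1)›]
  rw [Finset.sum_range_add, h1, h2] at hle
  refine (mul_le_mul_of_nonneg_left hle zero_le_two).trans ?_
  rw [← add_div, ← mul_div_assoc, div_le_iff₀ hW]
  cases m with
  | zero =>
    have := two_mul_sum_scaledBessel_one_le hμ N
    simp only [growingSol, Finset.range_zero, Finset.sum_empty, zero_add]
    linarith
  | succ m =>
    have hS := two_mul_sum_growingSol_le hμ m
    have hT := two_mul_sum_scaledBessel_le hμ (m + 1) N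
    have hc := casoratian_eq hμ (m + 1)
    have hr := scaledBessel_rec hμ.le (m + 1)
    have hr0 := scaledBessel_rec hμ.le 0
    have q1 := growingSol_nonneg hμ (m + 1)
    have q2 := growingSol_nonneg hμ (m + 2)
    have b1 := scaledBessel_pos hμ (m + 1)
    have b2 := scaledBessel_pos hμ (m + 2)
    have b3 := scaledBessel_pos hμ (m + 3)
    have hd := scaledBessel_succ_le hμ.le (m + 1)
    have hT' : 2 * ∑ i ∈ Finset.range N, scaledBessel μ (m + 1 + 1 + i) ≤
        μ * (scaledBessel μ (m + 1) / 2 + scaledBessel μ (m + 2) / 3) := by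
      refine hT.trans ?_
      have hm : (0 : ℝ) ≤ m := by positivity
      push_cast
      gcongr <;> linarith
    have hb : 4 * scaledBessel μ (m + 2) ≤ μ * scaledBessel μ (m + 1) := by
      push_cast at hr
      rw [show m + 1 + 2 = m + 3 from rfl, show m + 1 + 1 = m + 2 from rfl] at hr
      have : 0 ≤ (m : ℝ) * scaledBessel μ (m + 2) := by positivity
      have := mul_pos hμ b3
      linarith
    have hb0 : scaledBessel μ (m + 1) ≤ scaledBessel μ 0 :=
      antitone_nat_of_succ_le (scaledBessel_succ_le hμ.le) (Nat.zero_le _)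
    rw [show m + 1 + 1 = m + 2 from rfl] at *
    have e1 := mul_le_mul_of_nonneg_right hS b2.le
    have e2 := mul_le_mul_of_nonneg_right hT' q2
    generalize ∑ i ∈ Finset.range N, scaledBessel μ (m + 2 + i) = T at *
    generalize ∑ k ∈ Finset.range (m + 1), growingSol μ (k + 1) = S at *
    generalize scaledBessel μ (m + 2) = b at *
    generalize scaledBessel μ (m + 1) = a at *
    generalize scaledBessel μ 0 = A at *
    generalize growingSol μ (m + 2) = q at *
    generalize growingSol μ (m + 1) = p at *
    have hpb : 0 ≤ b * p := by positivity
    have hz1 : μ * (b * q) ≤ μ * A := by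
      have := mul_le_mul_of_nonneg_right hd q2
      exact mul_le_mul_of_nonneg_left (by linarith) hμ.le
    have hc' : μ * (a * q) + μ * (b * p) = μ * A := by rw [← hc]; ring
    rcases le_or_gt μ 2 with h | h
    · have hz2 : 2 * (b * q) ≤ A := by nlinarith [mul_le_mul_of_nonneg_right hb q2]
      have hz3 := mul_le_mul_of_nonneg_left hz2 hμ.le
      have hz4 := mul_le_mul_of_nonneg_left hb0 hμ.le
      have hz5 : 0 < μ * b := by positivity
      linarith
    · have hz5 : 2 * b ≤ μ * b := mul_le_mul_of_nonneg_right h.le b2.le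
      have : 0 < μ * A := hW
      linarith

/-! ### Assembling the inverse -/

lemma l1Mem_of_sum_le {a : ℕ → ℝ} {c : ℝ}
    (h : ∀ N, 2 * ∑ k ∈ Finset.range N, |a (k + 1)| ≤ c) : l1Mem a :=
  (summable_nat_add_iff 1).1 <| summable_of_sum_range_le (c := c / 2) (fun _ => abs_nonneg _)
    fun N => by linarith [h N]

lemma l1Norm_le_of_sum_le {a : ℕ → ℝ} {c : ℝ}
    (h : ∀ N, 2 * ∑ k ∈ Finset.range N, |a (k + 1)| ≤ c) : l1Norm a ≤ |a 0| + c := by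
  have := Real.tsum_le_of_sum_range_le (c := c / 2) (fun k => abs_nonneg (a (k + 1)))
    fun N => by linarith [h N]
  unfold l1Norm
  linarith

lemma l1Mem.succ {a : ℕ → ℝ} (ha : l1Mem a) : Summable fun k => |a (k + 1)| :=
  (summable_nat_add_iff 1).2 ha

lemma abs_alternating (a : ℕ → ℝ) (k : ℕ) : |(-1 : ℝ) ^ (k + 1) * a (k + 1)| = |a (k + 1)| := by
  simp [abs_mul]

lemma l1Mem.summable_alternating {a : ℕ → ℝ} (ha : l1Mem a) :
    Summable fun k => (-1 : ℝ) ^ (k + 1) * a (k + 1) :=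
  Summable.of_abs (by simpa only [abs_alternating] using ha.succ)

lemma abs_Lop_zero_le {μ : ℝ} {a : ℕ → ℝ} (ha : l1Mem a) : |Lop μ a 0| ≤ l1Norm a := by
  have h : |∑' k : ℕ, (-1 : ℝ) ^ (k + 1) * a (k + 1)| ≤ ∑' k : ℕ, |a (k + 1)| := by
    have := norm_tsum_le_tsum_norm (f := fun k : ℕ => (-1 : ℝ) ^ (k + 1) * a (k + 1))
      (by simpa only [Real.norm_eq_abs, abs_alternating] using ha.succ)
    simpa only [Real.norm_eq_abs, abs_alternating] using this
  unfold l1Norm Lop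
  refine (abs_add_le _ _).trans ?_
  rw [abs_mul, abs_two]
  gcongr

lemma Lop_add_smul {μ : ℝ} {a b : ℕ → ℝ} (ha : l1Mem a) (hb : l1Mem b) (c : ℝ) :
    Lop μ (fun k => a k + c * b k) = fun k => Lop μ a k + c * Lop μ b k := by
  funext k
  cases k with
  | zero =>
    have h := (ha.summable_alternating.hasSum.add (hb.summable_alternating.hasSum.mul_left c)).tsum_eq
    have e : ∀ k : ℕ, (-1 : ℝ) ^ (k + 1) * (a (k + 1) + c * b (k + 1)) =
        (-1 : ℝ) ^ (k + 1) * a (k + 1) + c * ((-1 : ℝ) ^ (k + 1) * b (k + 1)) := fun k => by ring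
    simp only [Lop, e, h]
    ring
  | succ k => simp only [Lop]; ring

lemma l1Mem_add_smul {a b : ℕ → ℝ} (ha : l1Mem a) (hb : l1Mem b) (c : ℝ) :
    l1Mem (fun k => a k + c * b k) := by
  have hb' : Summable fun k => |c * b k| := by
    simpa only [abs_mul] using hb.mul_left |c|
  exact Summable.of_nonneg_of_le (fun _ => abs_nonneg _) (fun _ => abs_add_le _ _) (ha.add hb')

lemma l1Norm_add_smul_le {a b : ℕ → ℝ} (ha : l1Mem a) (hb : l1Mem b) (c : ℝ) :
    l1Norm (fun k => a k + c * b k) ≤ l1Norm a + |c| * l1Norm b := by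
  have h : ∑' k : ℕ, |a (k + 1) + c * b (k + 1)| ≤
      ∑' k : ℕ, |a (k + 1)| + |c| * ∑' k : ℕ, |b (k + 1)| := by
    rw [← tsum_mul_left, ← ha.succ.tsum_add (hb.succ.mul_left _)]
    refine (l1Mem_add_smul ha hb c).succ.tsum_le_tsum (fun k => ?_)
      (ha.succ.add (hb.succ.mul_left _))
    rw [← abs_mul]
    exact abs_add_le _ _
  have h0 : |a 0 + c * b 0| ≤ |a 0| + |c| * |b 0| := by
    rw [← abs_mul]
    exact abs_add_le _ _
  unfold l1Norm
  linarith

/-- Superposition of solutions whose right-hand sides are unit sequences. -/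
lemma exists_superposition {μ c : ℝ} {p : ℕ → ℕ → ℝ} (hp0 : ∀ m, p m 0 = 0)
    (hp : ∀ m N, 2 * ∑ k ∈ Finset.range N, |p m (k + 1)| ≤ c)
    (hrec : ∀ m k, μ * p m k + 2 * ((k : ℝ) + 1) * p m (k + 1) - μ * p m (k + 2)
      = if k = m then 1 else 0) {y : ℕ → ℝ} (hy : l1Mem y) :
    ∃ b : ℕ → ℝ, l1Mem b ∧ (∀ k, Lop μ b (k + 1) = y (k + 1)) ∧
      l1Norm b ≤ c * ∑' m, |y (m + 1)| := by
  have hc (m k : ℕ) : |p m k| ≤ c / 2 := by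
    have hc0 : 0 ≤ c := by simpa using hp 0 0
    cases k with
    | zero => rw [hp0, abs_zero]; linarith
    | succ k =>
      have h1 := hp m (k + 1)
      have h2 : |p m (k + 1)| ≤ ∑ i ∈ Finset.range (k + 1), |p m (i + 1)| :=
        Finset.single_le_sum (f := fun i => |p m (i + 1)|) (fun _ _ => abs_nonneg _)
          (Finset.self_mem_range_succ k)
      linarith
  have hs (k : ℕ) : Summable fun m => |y (m + 1) * p m k| := by
    refine Summable.of_nonneg_of_le (fun _ => abs_nonneg _) (fun m => ?_) (hy.succ.mul_right (c / 2))
    rw [abs_mul]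
    exact mul_le_mul_of_nonneg_left (hc m k) (abs_nonneg _)
  have hs' (k : ℕ) : Summable fun m => y (m + 1) * p m k := (hs k).of_abs
  have hb (N : ℕ) : 2 * ∑ k ∈ Finset.range N, |∑' m, y (m + 1) * p m (k + 1)| ≤
      c * ∑' m, |y (m + 1)| := by
    calc 2 * ∑ k ∈ Finset.range N, |∑' m, y (m + 1) * p m (k + 1)|
        ≤ 2 * ∑ k ∈ Finset.range N, ∑' m, |y (m + 1) * p m (k + 1)| := by
          refine mul_le_mul_of_nonneg_left (Finset.sum_le_sum fun k _ => ?_) zero_le_two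
          exact norm_tsum_le_tsum_norm (f := fun m => y (m + 1) * p m (k + 1)) (hs (k + 1))
      _ = ∑' m, |y (m + 1)| * (2 * ∑ k ∈ Finset.range N, |p m (k + 1)|) := by
          rw [← Summable.tsum_finsetSum fun k _ => hs (k + 1), ← tsum_mul_left]
          refine tsum_congr fun m => ?_
          simp only [abs_mul, ← Finset.mul_sum]
          ring
      _ ≤ ∑' m, |y (m + 1)| * c := by
          have hle (m : ℕ) : |y (m + 1)| * (2 * ∑ k ∈ Finset.range N, |p m (k + 1)|)
              ≤ |y (m + 1)| * c := mul_le_mul_of_nonneg_left (hp m N) (abs_nonneg _)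
          exact Summable.tsum_le_tsum hle
            (Summable.of_nonneg_of_le (fun _ => by positivity) hle (hy.succ.mul_right c))
            (hy.succ.mul_right c)
      _ = c * ∑' m, |y (m + 1)| := by rw [tsum_mul_right, mul_comm]
  refine ⟨fun k => ∑' m, y (m + 1) * p m k, l1Mem_of_sum_le hb, fun k => ?_, ?_⟩
  · have h := (((hs' k).hasSum.mul_left μ).add
      ((hs' (k + 1)).hasSum.mul_left (2 * ((k : ℝ) + 1)))).sub ((hs' (k + 2)).hasSum.mul_left μ)
    have e (m : ℕ) : μ * (y (m + 1) * p m k) + 2 * ((k : ℝ) + 1) * (y (m + 1) * p m (k + 1))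
        - μ * (y (m + 1) * p m (k + 2)) = if m = k then y (k + 1) else 0 := by
      have := hrec m k
      rcases eq_or_ne m k with rfl | hmk
      · simp only [if_true] at this ⊢
        linear_combination y (m + 1) * this
      · rw [if_neg hmk.symm] at this
        rw [if_neg hmk]
        linear_combination y (m + 1) * this
    simp only [e] at h
    simp only [Lop]
    exact h.unique (hasSum_ite_eq k _)
  · simpa [hp0] using l1Norm_le_of_sum_le (a := fun k => ∑' m, y (m + 1) * p m k) hb

lemma exists_Lop_eq {μ : ℝ} {h : ℕ → ℝ} (hh : l1Mem h) (hpos : 0 < l1Norm h)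
    (hzero : Lop μ h 0 = l1Norm h) (hsucc : ∀ k, Lop μ h (k + 1) = 0)
    {p : ℕ → ℕ → ℝ} (hp0 : ∀ m, p m 0 = 0)
    (hp : ∀ m N, 2 * ∑ k ∈ Finset.range N, |p m (k + 1)| ≤ 1.45)
    (hrec : ∀ m k, μ * p m k + 2 * ((k : ℝ) + 1) * p m (k + 1) - μ * p m (k + 2)
      = if k = m then 1 else 0) {y : ℕ → ℝ} (hy : l1Mem y) :
    ∃ a : ℕ → ℝ, l1Mem a ∧ Lop μ a = y ∧ l1Norm a ≤ 1.45 * l1Norm y := by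
  obtain ⟨b, hb, hLb, hnb⟩ := exists_superposition hp0 hp hrec hy
  set c := (y 0 - Lop μ b 0) / l1Norm h with hc
  refine ⟨fun k => b k + c * h k, l1Mem_add_smul hb hh c, ?_, ?_⟩
  · rw [Lop_add_smul hb hh]
    funext k
    cases k with
    | zero => simp only [hzero, hc]; field_simp; ring
    | succ k => simp [hLb, hsucc]
  · have h1 := l1Norm_add_smul_le hb hh c
    have h2 : |c| * l1Norm h = |y 0 - Lop μ b 0| := by
      rw [hc, abs_div, abs_of_pos hpos, div_mul_cancel₀ _ hpos.ne']
    have h3 := abs_sub (y 0) (Lop μ b 0)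
    have h4 := abs_Lop_zero_le (μ := μ) hb
    have h5 := abs_nonneg (y 0)
    unfold l1Norm at *
    linarith

/-! ### The sequence `(-1)^k I_k` and uniqueness -/

lemma l1Mem_scaledBessel {μ : ℝ} (hμ : 0 < μ) : l1Mem (scaledBessel μ) :=
  l1Mem_of_sum_le fun N => by
    have := two_mul_sum_scaledBessel_one_le hμ N
    simpa only [abs_of_pos (scaledBessel_pos hμ _), add_comm 1] using this

lemma l1Mem_alternating_scaledBessel {μ : ℝ} (hμ : 0 < μ) :
    l1Mem fun k => (-1) ^ k * scaledBessel μ k := by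
  simpa [l1Mem, abs_mul] using l1Mem_scaledBessel hμ

lemma l1Norm_alternating_scaledBessel_pos {μ : ℝ} (hμ : 0 < μ) :
    0 < l1Norm fun k => (-1) ^ k * scaledBessel μ k := by
  unfold l1Norm
  have h1 : 0 ≤ ∑' j : ℕ, |(-1) ^ (j + 1) * scaledBessel μ (j + 1)| :=
    tsum_nonneg fun _ => abs_nonneg _
  have h2 := scaledBessel_pos hμ 0
  have h3 : 0 < |(-1) ^ 0 * scaledBessel μ 0| := by simpa using h2.ne'
  linarith

lemma Lop_alternating_scaledBessel_zero {μ : ℝ} (hμ : 0 < μ) :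
    Lop μ (fun k => (-1) ^ k * scaledBessel μ k) 0
      = l1Norm fun k => (-1) ^ k * scaledBessel μ k := by
  have e (k : ℕ) : (-1 : ℝ) ^ (k + 1) * ((-1) ^ (k + 1) * scaledBessel μ (k + 1))
      = |(-1) ^ (k + 1) * scaledBessel μ (k + 1)| := by
    rw [← mul_assoc, ← mul_pow, abs_mul, abs_of_pos (scaledBessel_pos hμ _)]
    simp
  simp only [Lop, l1Norm, e]
  simp [abs_of_pos (scaledBessel_pos hμ 0)]

lemma Lop_alternating_scaledBessel_succ {μ : ℝ} (hμ : 0 < μ) (k : ℕ) :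
    Lop μ (fun k => (-1) ^ k * scaledBessel μ k) (k + 1) = 0 := by
  simp only [Lop]
  linear_combination (-1) ^ k * scaledBessel_rec hμ.le k

/-- A summable sequence annihilated by the rows `≥ 1` of `L_μ` is a multiple of the minimal
solution. -/
lemma eq_smul_scaledBessel {μ : ℝ} (hμ : 0 < μ) {a : ℕ → ℝ} (ha : l1Mem a)
    (h : ∀ k, Lop μ a (k + 1) = 0) :
    ∀ k, a k = a 0 / scaledBessel μ 0 * ((-1) ^ k * scaledBessel μ k) := by
  have p0 := (scaledBessel_pos hμ 0).ne'
  set d : ℕ → ℝ := fun k => a k * scaledBessel μ (k + 1) + a (k + 1) * scaledBessel μ k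
    with hd
  have hconst (k : ℕ) : d k = d 0 := by
    induction k with
    | zero => rfl
    | succ k ih =>
      rw [← ih]
      have h1 := h k
      have h2 := scaledBessel_rec hμ.le k
      simp only [Lop] at h1
      refine mul_left_cancel₀ hμ.ne' ?_
      simp only [hd]
      linear_combination (-scaledBessel μ (k + 1)) * h1 - a (k + 1) * h2
  have hlim : Filter.Tendsto d Filter.atTop (nhds 0) := by
    have ta : Filter.Tendsto a Filter.atTop (nhds 0) := ha.of_abs.tendsto_atTop_zero
    have tb : Filter.Tendsto (scaledBessel μ) Filter.atTop (nhds 0) :=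
      (l1Mem_scaledBessel hμ).of_abs.tendsto_atTop_zero
    have ta' := ta.comp (Filter.tendsto_add_atTop_nat 1)
    have tb' := tb.comp (Filter.tendsto_add_atTop_nat 1)
    simpa [hd, Function.comp_def] using (ta.mul tb').add (ta'.mul tb)
  have hd0 : d 0 = 0 :=
    tendsto_nhds_unique (tendsto_const_nhds.congr fun k => (hconst k).symm) hlim
  have hstep (k : ℕ) : a k * scaledBessel μ (k + 1) + a (k + 1) * scaledBessel μ k = 0 :=
    (hconst k).trans hd0
  intro k
  induction k with
  | zero => field_simp
  | succ k ih =>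
    have hk := (scaledBessel_pos hμ k).ne'
    refine mul_right_cancel₀ hk ?_
    rw [pow_succ]
    linear_combination hstep k - scaledBessel μ (k + 1) * ih

lemma Lop_injective_of_pos {μ : ℝ} (hμ : 0 < μ) {a : ℕ → ℝ} (ha : l1Mem a)
    (h : Lop μ a = 0) : a = 0 := by
  have he := eq_smul_scaledBessel hμ ha fun k => congrFun h (k + 1)
  set c := a 0 / scaledBessel μ 0
  have hz := Lop_add_smul (μ := μ) (a := 0) (by simp [l1Mem, summable_zero])
    (l1Mem_alternating_scaledBessel hμ) c
  have h0 := congrFun hz 0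
  have e : (fun k => (0 : ℕ → ℝ) k + c * ((-1) ^ k * scaledBessel μ k)) = a := by
    funext k; simp [← he k]
  rw [e, h, Lop_alternating_scaledBessel_zero hμ] at h0
  have hp := (l1Norm_alternating_scaledBessel_pos hμ).ne'
  have hc : c = 0 := by
    simpa [Lop, hp] using h0
  funext k
  rw [he k, hc]
  simp

lemma Lop_zero_injective {a : ℕ → ℝ} (h : Lop 0 a = 0) : a = 0 := by
  have h1 (k : ℕ) : a (k + 1) = 0 := by
    have := congrFun h (k + 1)
    have hk : (k : ℝ) + 1 ≠ 0 := by positivity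
    simpa [Lop, hk] using this
  have h0 := congrFun h 0
  funext k
  cases k with
  | zero => simpa [Lop, h1] using h0
  | succ k => simpa using h1 k

lemma exists_Lop_zero_eq {y : ℕ → ℝ} (hy : l1Mem y) :
    ∃ a : ℕ → ℝ, l1Mem a ∧ Lop 0 a = y ∧ l1Norm a ≤ 1.45 * l1Norm y := by
  refine exists_Lop_eq (h := fun k => if k = 0 then 1 else 0)
    (p := fun m k => if k = m + 1 then 1 / (2 * ((m : ℝ) + 1)) else 0)
    ?_ ?_ ?_ ?_ ?_ ?_ ?_ hy
  · exact l1Mem_of_sum_le (c := 0) (by simp)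
  · simp [l1Norm]
  · simp [Lop, l1Norm]
  · simp [Lop]
  · simp
  · intro m N
    have hm : (0 : ℝ) < (m : ℝ) + 1 := by positivity
    have e (k : ℕ) : |if k + 1 = m + 1 then 1 / (2 * ((m : ℝ) + 1)) else 0|
        = if m = k then 1 / (2 * ((m : ℝ) + 1)) else 0 := by
      by_cases hk : k = m
      · simp [hk, abs_of_pos hm]
      · simp [hk, Ne.symm hk]
    simp only [e, Finset.sum_ite_eq]
    have : 1 / (2 * ((m : ℝ) + 1)) ≤ 1 / 2 := by
      gcongr
      have : (0 : ℝ) ≤ m := by positivity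
      linarith
    split_ifs
    · linarith
    · norm_num
  · intro m k
    have hm : (m : ℝ) + 1 ≠ 0 := by positivity
    by_cases hk : k = m
    · subst hk
      simp
      field_simp
    · simp [hk]

lemma exists_Lop_eq_of_pos {μ : ℝ} (hμ : 0 < μ) {y : ℕ → ℝ} (hy : l1Mem y) :
    ∃ a : ℕ → ℝ, l1Mem a ∧ Lop μ a = y ∧ l1Norm a ≤ 1.45 * l1Norm y :=
  exists_Lop_eq (l1Mem_alternating_scaledBessel hμ) (l1Norm_alternating_scaledBessel_pos hμ)
    (Lop_alternating_scaledBessel_zero hμ) (Lop_alternating_scaledBessel_succ hμ)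
    (p := greenCol μ) (fun m => by simp [greenCol, growingSol]) (sum_abs_greenCol_le hμ)
    (greenCol_rec hμ) hy

/-- For every `μ ∈ [0, 1000]`, `L_μ` is boundedly invertible on `ℓ¹` with
`‖L_μ⁻¹‖ ≤ 1.45`. -/
theorem stmt17 (μ : ℝ) (h0 : 0 ≤ μ) (h1 : μ ≤ 1000) :
    ∀ y : ℕ → ℝ, l1Mem y →
      ∃ a : ℕ → ℝ,
        (l1Mem a ∧ Lop μ a = y ∧ l1Norm a ≤ 1.45 * l1Norm y) ∧
        ∀ a' : ℕ → ℝ, l1Mem a' → Lop μ a' = y → a' = a := by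
  intro y hy
  have hinj (d : ℕ → ℝ) (hd : l1Mem d) (hz : Lop μ d = 0) : d = 0 := by
    rcases h0.eq_or_lt with rfl | hμ
    · exact Lop_zero_injective hz
    · exact Lop_injective_of_pos hμ hd hz
  obtain ⟨a, ha, hLa, hna⟩ : ∃ a : ℕ → ℝ, l1Mem a ∧ Lop μ a = y ∧ l1Norm a ≤ 1.45 * l1Norm y := by
    rcases h0.eq_or_lt with rfl | hμ
    · exact exists_Lop_zero_eq hy
    · exact exists_Lop_eq_of_pos hμ hy
  refine ⟨a, ⟨ha, hLa, hna⟩, fun a' ha' hLa' => ?_⟩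
  have hd := hinj _ (l1Mem_add_smul ha' ha (-1)) (by
    rw [Lop_add_smul ha' ha, hLa, hLa']
    funext k
    simp)
  funext k
  have := congrFun hd k
  simp only [Pi.zero_apply] at this
  linarith
end
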